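/- Let O be a W-orbit in ℝ^r and t ∈ T_O. For every affine root a = (α, n) with α ∈ Φ_0^+ and n ∈ ℤ, and every y ∈ O: G_t^O(a)(x^y) − 𝐤_a^{−η_e(α(y))}·𝐤_{a/2}^{−η_o(α(y))}·x^y ∈ span_F{x^{y'} : y' < y}. -/

import Mathlib

open scoped Classical

noncomputable section

namespace QP

/-! ### The space of quasi-polynomials -/

/-- Euclidean space `ℝ^r`. -/
abbrev E (r : ℕ) := Fin r → ℝ

variable (F : Type*) [Field F] [CharZero F] (r : ℕ)

/-- The algebra of quasi-polynomials `F[ℝ^r]`: the group algebra of `(ℝ^r,+)` over `F`. -/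
abbrev QA := AddMonoidAlgebra F (E r)

/-- The quasi-monomial `x^y`. -/
def X (y : E r) : QA F r := AddMonoidAlgebra.single y 1

/-- The `i`-th coordinate of a vector (`1`-based). -/
def cd (y : E r) (i : ℕ) : ℝ := ∑ m : Fin r, if (m : ℕ) + 1 = i then y m else 0

/-- The standard basis vector `ε_i` (`1`-based). -/
def epsV (i : ℕ) : E r := fun m => if (m : ℕ) + 1 = i then 1 else 0

/-- The standard basis vector (`0`-based). -/
def eV (m : Fin r) : E r := fun n => if n = m then 1 else 0

/-- The Euclidean inner product on `ℝ^r`. -/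
def ip (v y : E r) : ℝ := ∑ m : Fin r, v m * y m

/-- An integral vector regarded as an element of `ℝ^r`. -/
def zc (lam : Fin r → ℤ) : E r := fun m => (lam m : ℝ)

/-- The simple reflections of the hyperoctahedral group `W₀ = S_r ⋉ (±1)^r` (`1`-based):
for `1 ≤ i < r`, `sW i` interchanges the `i`-th and `(i+1)`-st coordinates, and
`sW r` negates the last coordinate. -/
def sW (i : ℕ) (y : E r) : E r := fun m =>
  if i = r then (if (m : ℕ) + 1 = r then -y m else y m)
  else if (m : ℕ) + 1 = i then cd r y (i + 1)
  else if (m : ℕ) = i then cd r y i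
  else y m

/-- `s_{ε₁} = s₁⋯s_{r-1} s_r s_{r-1}⋯s₁`: negation of the first coordinate. -/
def sEps1 (y : E r) : E r := fun m => if (m : ℕ) = 0 then -y m else y m

/-- The affine simple reflection `s₀ = τ(ε₁) s_{ε₁} : y ↦ (1 - y₁, y₂, …, y_r)`, together
with `genF j = sW j` for `1 ≤ j ≤ r`: the Coxeter generators of the affine Weyl group
`W = W₀ ⋉ ℤ^r`. -/
def genF (j : ℕ) (y : E r) : E r :=
  if j = 0 then fun m => if (m : ℕ) = 0 then 1 - y m else y m
  else sW r j y

/-- The action of the word `s_{j₁} ⋯ s_{j_ℓ}` on `ℝ^r`. -/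
def wordAct (l : List ℕ) (y : E r) : E r := l.foldr (genF r) y

/-- The closure of the fundamental alcove
`C₊ = {y : 0 < y_r < ⋯ < y₁ < 1/2}`. -/
def CplusCl : Set (E r) :=
  {y | (∀ i j : Fin r, i ≤ j → y j ≤ y i) ∧ ∀ m : Fin r, 0 ≤ y m ∧ y m ≤ 1 / 2}

/-- The `W`-orbit of a point of `ℝ^r`. -/
def orbit (y : E r) : Set (E r) :=
  {z | ∃ l : List ℕ, (∀ a ∈ l, a ≤ r) ∧ wordAct r l y = z}

/-- `O` is a `W`-orbit in `ℝ^r`. -/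
def IsOrbit (O : Set (E r)) : Prop := ∃ y, O = orbit r y

/-- `c^𝒪`: the unique point of the orbit `O` lying in the closed fundamental alcove. -/
def cpt (O : Set (E r)) : E r :=
  if h : ∃ c, c ∈ O ∧ c ∈ CplusCl r then h.choose else 0

/-- The length of an element of the affine Weyl group `W` (as a map on `ℝ^r`). -/
def wlen (g : E r → E r) : ℕ :=
  sInf {n | ∃ l : List ℕ, (∀ a ∈ l, a ≤ r) ∧ l.length = n ∧ (fun y => wordAct r l y) = g}

/-- A choice of a shortest word `l` whose inverse maps `y` into the closed alcove;
the corresponding element of `W` is `g_y`. -/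
def gW (y : E r) : List ℕ :=
  if h : ∃ l : List ℕ, (∀ a ∈ l, a ≤ r) ∧ wordAct r l.reverse y ∈ CplusCl r ∧
      ∀ l' : List ℕ, (∀ a ∈ l', a ≤ r) → wordAct r l'.reverse y ∈ CplusCl r →
        l.length ≤ l'.length
  then h.choose else []

/-- `g_y`, the unique shortest element of `W` with `g_y⁻¹ y` in the closed alcove. -/
def gfun (y : E r) : E r → E r := fun z => wordAct r (gW r y) z

/-- The Bruhat order on `(W, {s₀,…,s_r})`, via the subword characterisation. -/
def bruhatLE (u v : E r → E r) : Prop :=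
  ∃ l : List ℕ, (∀ a ∈ l, a ≤ r) ∧ (fun z => wordAct r l z) = v ∧ l.length = wlen r v ∧
    ∃ l' : List ℕ, l'.Sublist l ∧ (fun z => wordAct r l' z) = u ∧ l'.length = wlen r u

/-- The partial order on `ℝ^r`: `y' ≤ y` iff `y'` and `y` lie in the same `W`-orbit and
`g_{y'} ≤_B g_y` in the Bruhat order. -/
def qle (y' y : E r) : Prop :=
  (∃ l : List ℕ, (∀ a ∈ l, a ≤ r) ∧ wordAct r l y = y') ∧ bruhatLE r (gfun r y') (gfun r y)

/-- Strict version of `qle`. -/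
def qlt (y' y : E r) : Prop := qle r y' y ∧ y' ≠ y

/-- The `F`-linear operator on `F[ℝ^r]` determined by its values on the quasi-monomials. -/
def mkOp (Ψ : E r → QA F r) : Module.End F (QA F r) :=
  Finsupp.linearCombination F Ψ ∘ₗ (AddMonoidAlgebra.coeffLinearEquiv F).toLinearMap

/-- `F[O] = span_F {x^y : y ∈ O}`. -/
def FO (O : Set (E r)) : Submodule F (QA F r) :=
  Submodule.span F {p | ∃ y ∈ O, p = X F r y}

/-- The Laurent polynomial subalgebra `F[ℤ^r] = span_F {x^μ : μ ∈ ℤ^r}`. -/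
def Lspan : Submodule F (QA F r) :=
  Submodule.span F {p | ∃ lam : Fin r → ℤ, p = X F r (zc r lam)}

/-- `span_F {x^{y'} : y' < y}`. -/
def ltSpan (y : E r) : Submodule F (QA F r) :=
  Submodule.span F {p | ∃ y', qlt r y' y ∧ p = X F r y'}

/-! ### Floors and indicator/sign functions -/

/-- the largest even integer `≤ z` -/
def floorE (z : ℝ) : ℤ := 2 * ⌊z / 2⌋
/-- the largest odd integer `≤ z` -/
def floorO (z : ℝ) : ℤ := 2 * ⌊(z + 1) / 2⌋ - 1
/-- indicator of `ℤ ⊆ ℝ` -/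
def chiZ (z : ℝ) : ℕ := if ∃ n : ℤ, z = n then 1 else 0
/-- indicator of the even integers -/
def chiE (z : ℝ) : ℕ := if ∃ n : ℤ, z = 2 * n then 1 else 0
/-- indicator of the odd integers -/
def chiO (z : ℝ) : ℕ := if ∃ n : ℤ, z = 2 * n + 1 then 1 else 0
/-- `η_e`: `1` on even integers `≥ 2`, `-1` on even integers `≤ 0`, `0` otherwise -/
def etaE (z : ℝ) : ℤ := if ∃ n : ℤ, z = 2 * n then (if 2 ≤ z then 1 else -1) else 0
/-- `η_o`: `1` on odd integers `≥ 1`, `-1` on odd integers `≤ -1`, `0` otherwise -/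
def etaO (z : ℝ) : ℤ := if ∃ n : ℤ, z = 2 * n + 1 then (if 1 ≤ z then 1 else -1) else 0
/-- `η = η_e + η_o` -/
def eta (z : ℝ) : ℤ := etaE z + etaO z

/-- `geomS c v m` is the truncated geometric series `(1 - (c·x^v)^m)/(1 - c·x^v)`,
a genuine element of `F[ℝ^r]`; it is the unique element with
`(1 - c·x^v) * geomS c v m = 1 - c^m·x^{m v}`. -/
def geomS (c : F) (v : E r) (m : ℤ) : QA F r :=
  if 0 ≤ m then ∑ t ∈ Finset.range m.toNat, c ^ (t : ℤ) • X F r ((t : ℝ) • v)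
  else -∑ t ∈ Finset.range (-m).toNat, c ^ (-(t : ℤ) - 1) • X F r ((-(t : ℝ) - 1) • v)

/-! ### Truncated divided difference operators and Demazure–Lusztig operators -/

/-- `∇_i(x^y) = ((1 - (x_{i+1}/x_i)^{⌊y_i - y_{i+1}⌋})/(1 - x_i/x_{i+1}))·x^y`. -/
def nablaIel (i : ℕ) (y : E r) : QA F r :=
  geomS F r 1 (epsV r i - epsV r (i + 1)) (-⌊cd r y i - cd r y (i + 1)⌋) * X F r y

/-- `∇_r^e(x^y) = ((1 - x_r^{-⌊2y_r⌋_e})/(1 - x_r^2))·x^y`. -/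
def nablaReEl (y : E r) : QA F r :=
  geomS F r 1 ((2 : ℝ) • epsV r r) (-floorE (2 * cd r y r) / 2) * X F r y

/-- `∇_r^o(x^y) = ((x_r - x_r^{-⌊2y_r⌋_o})/(1 - x_r^2))·x^y`. -/
def nablaRoEl (y : E r) : QA F r :=
  X F r (epsV r r) *
    geomS F r 1 ((2 : ℝ) • epsV r r) ((-floorO (2 * cd r y r) - 1) / 2) * X F r y

def nablaIop (i : ℕ) : Module.End F (QA F r) := mkOp F r (nablaIel F r i)
def nablaReOp : Module.End F (QA F r) := mkOp F r (nablaReEl F r)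
def nablaRoOp : Module.End F (QA F r) := mkOp F r (nablaRoEl F r)

/-- The value of the truncated Demazure–Lusztig operator `T_i` (`1 ≤ i ≤ r`) on `x^y`. -/
def Tel (k kr ur : F) (i : ℕ) (y : E r) : QA F r :=
  if i = r then
    (kr ^ chiE (2 * cd r y r) * ur ^ chiO (2 * cd r y r)) • X F r (sW r r y)
      + (kr - kr⁻¹) • nablaReEl F r y + (ur - ur⁻¹) • nablaRoEl F r y
  else
    k ^ chiZ (cd r y i - cd r y (i + 1)) • X F r (sW r i y)
      + (k - k⁻¹) • nablaIel F r i y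

/-- The truncated Demazure–Lusztig operators `T_1, …, T_r` on `F[ℝ^r]`. -/
def Top (k kr ur : F) (i : ℕ) : Module.End F (QA F r) := mkOp F r (Tel F r k kr ur i)

/-! ### The torus and the affine generator -/

/-- `t^{ε_i}`: the `i`-th coordinate (`1`-based) of an element of the torus `T = (Fˣ)^r`. -/
def tcU (t : Fin r → Fˣ) (i : ℕ) : Fˣ := ∏ m : Fin r, if (m : ℕ) + 1 = i then t m else 1

/-- `t^λ` for `λ ∈ ℤ^r`. -/
def upow (t : Fin r → Fˣ) (lam : Fin r → ℤ) : Fˣ := ∏ m : Fin r, t m ^ lam m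

/-- `t^v` for a vector `v` with integral entries (entries read off via the floor). -/
def upowR (t : Fin r → Fˣ) (v : E r) : Fˣ := ∏ m : Fin r, t m ^ ⌊v m⌋

/-- The `W`-action on the torus `T = (Fˣ)^r`: for `g = τ(λ)w₀ ∈ W` (so `g y = w₀ y + λ`),
`(g t)_m = q^{λ_m} · t^{w₀⁻¹ ε_m}`, where `W₀` permutes and inverts coordinates and
`τ(λ) t = q^λ t`, with `q = (q^{1/2})²`. -/
def torusAct (qh : Fˣ) (g : E r → E r) (t : Fin r → Fˣ) : Fin r → Fˣ := fun m =>
  (qh * qh) ^ ⌊g 0 m⌋ * ∏ j : Fin r, t j ^ ⌊(g (eV r j) - g 0) m⌋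

/-- The action on the torus of the linear part of `g` alone (the `W₀`-action). -/
def torusAct0 (g : E r → E r) (t : Fin r → Fˣ) : Fin r → Fˣ := fun m =>
  ∏ j : Fin r, t j ^ ⌊(g (eV r j) - g 0) m⌋

/-- The simple affine roots `α₀(y) = 1 - 2y₁`, `α_i(y) = y_i - y_{i+1}` (`1 ≤ i < r`),
`α_r(y) = 2 y_r` as affine-linear functionals. -/
def alphaF (j : ℕ) (y : E r) : ℝ :=
  if j = 0 then 1 - 2 * cd r y 1
  else if j = r then 2 * cd r y r
  else cd r y j - cd r y (j + 1)

/-- `t^{α_j^∨}` where `α₀^∨ = (-ε₁, 1/2)`, `α_i^∨ = (ε_i - ε_{i+1}, 0)`, `α_r^∨ = (ε_r, 0)`. -/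
def tpowCo (qh : Fˣ) (t : Fin r → Fˣ) (j : ℕ) : Fˣ :=
  if j = 0 then qh * (tcU F r t 1)⁻¹
  else if j = r then tcU F r t r
  else tcU F r t j * (tcU F r t (j + 1))⁻¹

/-- The affine subtorus `T_𝒪 = {t ∈ T : t^{α_j^∨} = 1 whenever α_j(c^𝒪) = 0}`. -/
def TOset (qh : Fˣ) (O : Set (E r)) : Set (Fin r → Fˣ) :=
  {t | ∀ j : ℕ, j ≤ r → alphaF r j (cpt r O) = 0 → tpowCo F r qh t j = 1}

/-- `∇₀^e(x^y) = ((1 - (q^{-1/2}x₁)^{⌊-2y₁⌋_e})/(1 - q x₁^{-2}))·x^y`. -/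
def nabla0eEl (qh : F) (y : E r) : QA F r :=
  geomS F r (qh * qh) ((-2 : ℝ) • epsV r 1) (-floorE (-2 * cd r y 1) / 2) * X F r y

/-- `∇₀^o(x^y) = ((q^{1/2}x₁^{-1} - (q^{-1/2}x₁)^{⌊-2y₁⌋_o})/(1 - q x₁^{-2}))·x^y`. -/
def nabla0oEl (qh : F) (y : E r) : QA F r :=
  (qh • X F r ((-1 : ℝ) • epsV r 1)) *
    geomS F r (qh * qh) ((-2 : ℝ) • epsV r 1) ((-floorO (-2 * cd r y 1) - 1) / 2) * X F r y

/-- The value of `T₀^𝒪` on `x^y`. -/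
def T0el (qh : Fˣ) (k0 u0 : F) (t : Fin r → Fˣ) (y : E r) : QA F r :=
  (k0 ^ chiE (2 * cd r y 1) * u0 ^ chiO (2 * cd r y 1) *
      ((tcU F r (torusAct F r qh (gfun r y) t) 1 : Fˣ) : F)) • X F r (sEps1 r y)
    + (k0 - k0⁻¹) • nabla0eEl F r qh y + (u0 - u0⁻¹) • nabla0oEl F r qh y

/-- The operator `T₀^𝒪` (as a globally defined operator; on `F[𝒪]` it is the operator of
the quasi-polynomial representation). -/
def T0op (qh : Fˣ) (k0 u0 : F) (t : Fin r → Fˣ) : Module.End F (QA F r) :=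
  mkOp F r (T0el F r qh k0 u0 t)

/-- The full family `T₀^𝒪, T₁, …, T_r`. -/
def Tfull (qh : Fˣ) (k0 u0 k kr ur : F) (t : Fin r → Fˣ) (j : ℕ) : Module.End F (QA F r) :=
  if j = 0 then T0op F r qh k0 u0 t else Top F r k kr ur j

/-- The Hecke parameter `k_j` (`k₀`, `k` or `k_r`). -/
def kpar (k0 k kr : F) (j : ℕ) : F := if j = 0 then k0 else if j = r then kr else k

/-- `(T_j^𝒪)⁻¹ = T_j^𝒪 - k_j + k_j⁻¹` (the inverse on `F[𝒪]`, by the Hecke relation). -/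
def TfullInv (qh : Fˣ) (k0 u0 k kr ur : F) (t : Fin r → Fˣ) (j : ℕ) : Module.End F (QA F r) :=
  Tfull F r qh k0 u0 k kr ur t j - (kpar F r k0 k kr j - (kpar F r k0 k kr j)⁻¹) • 1

/-- The word `0, 1, …, r-1, r, r-1, …, i` used in the definition of `Y_i^𝒪`. -/
def Ylist (i : ℕ) : List ℕ :=
  0 :: (((List.range (r - 1)).map (· + 1)) ++ [r] ++ ((List.range (r - i)).map fun m => r - 1 - m))

/-- The commuting operators
`Y_i^𝒪 = (T_{i-1}^𝒪)⁻¹⋯(T₁^𝒪)⁻¹ · T₀^𝒪 · T₁^𝒪⋯T_{r-1}^𝒪 · T_r^𝒪 · T_{r-1}^𝒪⋯T_i^𝒪`. -/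
def Yop (qh : Fˣ) (k0 u0 k kr ur : F) (t : Fin r → Fˣ) (i : ℕ) : Module.End F (QA F r) :=
  ((((List.range (i - 1)).map (· + 1)).reverse.map (TfullInv F r qh k0 u0 k kr ur t)).prod) *
    (((Ylist r i).map (Tfull F r qh k0 u0 k kr ur t)).prod)

/-! ### The base points `𝔰^𝒪`, `𝔰_y` and the spectrum -/

/-- `n_i^𝒪` (with `c = c^𝒪`), resp. `m_i(y)` (with `c = y`). -/
def nO (c : E r) (m : Fin r) : ℤ :=
  (∑ j : Fin r, if m < j then eta (c m - c j) + eta (c m + c j) else 0) +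
    ∑ j : Fin r, if j < m then eta (c j + c m) - eta (c j - c m) else 0

/-- The base point `𝔰^𝒪 ∈ T`. -/
def sOtor (k0 u0 k kr ur : Fˣ) (O : Set (E r)) : Fin r → Fˣ := fun m =>
  (k0 * kr) ^ (-(chiE (2 * cpt r O m) : ℤ)) * (u0 * ur) ^ (chiO (2 * cpt r O m) : ℤ) *
    k ^ nO r (cpt r O) m

/-- The eigenvalue `γ_i^𝒪(y) = ((g_y(𝔰^𝒪·t))_i)⁻¹`. -/
def gammaO (qh k0 u0 k kr ur : Fˣ) (O : Set (E r)) (t : Fin r → Fˣ) (i : ℕ) (y : E r) : Fˣ :=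
  (tcU F r (torusAct F r qh (gfun r y) fun m => sOtor F r k0 u0 k kr ur O m * t m) i)⁻¹

/-- `𝔰_y ∈ T`. -/
def sfrak (k0 u0 k kr ur : Fˣ) (y : E r) : Fin r → Fˣ := fun m =>
  (k0 * kr) ^ etaE (2 * y m) * (u0 * ur) ^ etaO (2 * y m) * k ^ nO r y m

/-! ### Finite Weyl group combinatorics, positive roots -/

/-- The set of positive roots of type `C_r`. -/
def PhiPlus : Set (E r) :=
  {v | (∃ a b : Fin r, a < b ∧ v = eV r a - eV r b) ∨
       (∃ a b : Fin r, a < b ∧ v = eV r a + eV r b) ∨ ∃ a : Fin r, v = (2 : ℝ) • eV r a}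

/-- The root system of type `C_r`. -/
def Phi0 : Set (E r) := PhiPlus r ∪ {v | -v ∈ PhiPlus r}

/-- The normalisation factor `κ_w^𝒪 = ∏_{α ∈ Π(w)} 𝐤_α^{χ_e(α(c))}·𝐤_{α/2}^{-χ_o(α(c))}`,
where `Π(w) = {α ∈ Φ₀⁺ : wα ∈ -Φ₀⁺}`, `𝐤_α = 𝐤_{α/2} = k` for short roots and
`𝐤_α = k_r`, `𝐤_{α/2} = u_r` for long roots. -/
def kappaW (k kr ur : Fˣ) (w : E r → E r) (c : E r) : Fˣ :=
  (∏ p : Fin r × Fin r,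
      if p.1 < p.2 ∧ -w (eV r p.1 - eV r p.2) ∈ PhiPlus r then
        k ^ ((chiE (ip r (eV r p.1 - eV r p.2) c) : ℤ) - (chiO (ip r (eV r p.1 - eV r p.2) c) : ℤ))
      else 1) *
  (∏ p : Fin r × Fin r,
      if p.1 < p.2 ∧ -w (eV r p.1 + eV r p.2) ∈ PhiPlus r then
        k ^ ((chiE (ip r (eV r p.1 + eV r p.2) c) : ℤ) - (chiO (ip r (eV r p.1 + eV r p.2) c) : ℤ))
      else 1) *
  ∏ a : Fin r,
      if -w ((2 : ℝ) • eV r a) ∈ PhiPlus r then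
        kr ^ (chiE (ip r ((2 : ℝ) • eV r a) c) : ℤ) * ur ^ (-(chiO (ip r ((2 : ℝ) • eV r a) c) : ℤ))
      else 1

/-- Iterated application `T_{i₁}(T_{i₂}(⋯(T_{i_ℓ}(f))⋯))`. -/
def applyT (k kr ur : F) (l : List ℕ) (f : QA F r) : QA F r :=
  l.foldr (fun i g => Top F r k kr ur i g) f

/-- The length function of the finite Weyl group `W₀`. -/
def w0len (g : E r → E r) : ℕ :=
  sInf {n | ∃ l : List ℕ, (∀ a ∈ l, 1 ≤ a ∧ a ≤ r) ∧ l.length = n ∧ (fun y => wordAct r l y) = g}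

/-- Membership in `W₀` (as maps on `ℝ^r`). -/
def IsW0fun (w : E r → E r) : Prop :=
  ∃ l : List ℕ, (∀ a ∈ l, 1 ≤ a ∧ a ≤ r) ∧ w = fun y => wordAct r l y

/-- Membership in the parabolic subgroup `W_{0,𝒪}` generated by the `s_i`, `1 ≤ i ≤ r`,
with `α_i(c^𝒪) = 0`. -/
def IsWOOfun (O : Set (E r)) (u : E r → E r) : Prop :=
  ∃ l : List ℕ, (∀ a ∈ l, 1 ≤ a ∧ a ≤ r ∧ alphaF r a (cpt r O) = 0) ∧
    u = fun y => wordAct r l y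

/-- `v ∈ W₀^𝒪`: `v ∈ W₀` of minimal length in its coset `v·W_{0,𝒪}`. -/
def MinRep (O : Set (E r)) (v : E r → E r) : Prop :=
  IsW0fun r v ∧ ∀ u, IsWOOfun r O u → w0len r v ≤ w0len r fun y => v (u y)

/-- Membership in the affine Weyl group `W` (as maps on `ℝ^r`). -/
def IsWfun (g : E r → E r) : Prop :=
  ∃ l : List ℕ, (∀ a ∈ l, a ≤ r) ∧ g = fun y => wordAct r l y

/-- Membership in the parabolic subgroup `W_{J(𝒪)}` generated by the `s_j`, `j ∈ J(𝒪)`. -/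
def IsWJfun (O : Set (E r)) (u : E r → E r) : Prop :=
  ∃ l : List ℕ, (∀ a ∈ l, a ≤ r ∧ alphaF r a (cpt r O) = 0) ∧ u = fun y => wordAct r l y

/-- The `W`-action on the Laurent polynomials `F[ℤ^r]` by `q`-dilations and reflections:
`w(x^μ) = x^{wμ}` for `w ∈ W₀`, `τ(λ)(x^μ) = q^{-⟨μ,λ⟩} x^μ` (globally defined via the
linear/translation parts of `g`). -/
def LWact (qh : Fˣ) (g : E r → E r) : Module.End F (QA F r) :=
  mkOp F r fun v => (((qh * qh) ^ (-⌊ip r (g v - g 0) (g 0)⌋) : Fˣ) : F) • X F r (g v - g 0)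

/-! ### roots `ᾱ_j`, torus reflections -/

/-- The finite simple roots `ᾱ₀ = -2ε₁`, `ᾱ_i = ε_i - ε_{i+1}`, `ᾱ_r = 2ε_r`
(as integral vectors). -/
def abarI (j : ℕ) : Fin r → ℤ := fun m =>
  if j = 0 then (if (m : ℕ) = 0 then -2 else 0)
  else if j = r then (if (m : ℕ) + 1 = r then 2 else 0)
  else if (m : ℕ) + 1 = j then 1
  else if (m : ℕ) = j then -1
  else 0

/-- The corresponding coroots `ᾱ₀^∨ = -ε₁`, `ᾱ_i^∨ = ε_i - ε_{i+1}`, `ᾱ_r^∨ = ε_r`. -/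
def abarV (j : ℕ) : Fin r → ℤ := fun m =>
  if j = 0 then (if (m : ℕ) = 0 then -1 else 0)
  else if j = r then (if (m : ℕ) + 1 = r then 1 else 0)
  else if (m : ℕ) + 1 = j then 1
  else if (m : ℕ) = j then -1
  else 0

/-- `ᾱ_j` as a real vector. -/
def abarR (j : ℕ) : E r := fun m => ((abarI r j m : ℤ) : ℝ)

/-- The constants `c₀ = u₀u_r`, `c_i = k²`, `c_r = k₀k_r`. -/
def cpar (k0 u0 k kr ur : Fˣ) (j : ℕ) : Fˣ :=
  if j = 0 then u0 * ur else if j = r then k0 * kr else k * k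

/-- The action of the reflection `s_{ᾱ_j} ∈ W₀` on the torus `T` (with `s_{ᾱ₀} = s_{ε₁}`). -/
def sTor (j : ℕ) (t : Fin r → Fˣ) : Fin r → Fˣ := fun m =>
  if j = 0 then (if (m : ℕ) = 0 then (t m)⁻¹ else t m)
  else if j = r then (if (m : ℕ) + 1 = r then (t m)⁻¹ else t m)
  else if (m : ℕ) + 1 = j then tcU F r t (j + 1)
  else if (m : ℕ) = j then tcU F r t j
  else t m

/-! ### The operators `G_t^𝒪(a)` for affine roots `a = (α, n)` -/

/-- The coroot `α^∨ = 2α/⟨α,α⟩`. -/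
def coroot (v : E r) : E r := ((2 : ℝ) / ip r v v) • v

/-- The scalar `q^{2n/⟨α,α⟩}` appearing in `x^{a^∨}` for `a = (α,n)`. -/
def qsc (qh : Fˣ) (v : E r) (n : ℤ) : Fˣ := if ip r v v = 4 then qh ^ n else (qh * qh) ^ n

/-- `𝐤_a`: `k` if `α` is short; `k_r` if `α` long, `n` even; `k₀` if `α` long, `n` odd. -/
def kaf (k0 k kr : Fˣ) (v : E r) (n : ℤ) : Fˣ :=
  if ip r v v = 4 then (if Even n then kr else k0) else k

/-- `𝐤_{a/2}`: `k` if `α` is short; `u_r` if `α` long, `n` even; `u₀` if `α` long, `n` odd. -/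
def khaf (u0 k ur : Fˣ) (v : E r) (n : ℤ) : Fˣ :=
  if ip r v v = 4 then (if Even n then ur else u0) else k

/-- The reflection `s_α(y) = y - α(y)·α^∨`. -/
def sRefl (v y : E r) : E r := y - ip r v y • coroot r v

/-- `s_{a,t}(x^y) = (g_y t)^{-n α^∨} · x^{s_α y}`. -/
def saTel (qh : Fˣ) (t : Fin r → Fˣ) (v : E r) (n : ℤ) (y : E r) : QA F r :=
  ((upowR F r (torusAct F r qh (gfun r y) t) (((-n : ℤ) : ℝ) • coroot r v) : Fˣ) : F) •
    X F r (sRefl r v y)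

/-- The twisted reflection operator `s_{a,t}`. -/
def SaOp (qh : Fˣ) (t : Fin r → Fˣ) (v : E r) (n : ℤ) : Module.End F (QA F r) :=
  mkOp F r (saTel F r qh t v n)

/-- The value `G_t^𝒪(a)(x^y)` for the affine root `a = (v, n)`. -/
def Gel (qh k0 u0 k kr ur : Fˣ) (t : Fin r → Fˣ) (v : E r) (n : ℤ) (y : E r) : QA F r :=
  (((kaf F r k0 k kr v n : Fˣ) : F) ^ chiE (ip r v y) *
      ((khaf F r u0 k ur v n : Fˣ) : F) ^ chiO (ip r v y)) • X F r y
    + ((((kaf F r k0 k kr v n : Fˣ) : F) - ((kaf F r k0 k kr v n : Fˣ) : F)⁻¹) •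
          geomS F r (((qsc F r qh v n)⁻¹ * (qsc F r qh v n)⁻¹ : Fˣ) : F)
            ((-2 : ℝ) • coroot r v) (-floorE (ip r v y) / 2)
        + (((khaf F r u0 k ur v n : Fˣ) : F) - ((khaf F r u0 k ur v n : Fˣ) : F)⁻¹) •
          ((((qsc F r qh v n)⁻¹ : Fˣ) : F) • X F r ((-1 : ℝ) • coroot r v) *
            geomS F r (((qsc F r qh v n)⁻¹ * (qsc F r qh v n)⁻¹ : Fˣ) : F)
              ((-2 : ℝ) • coroot r v) (-(floorO (ip r v y) + 1) / 2))) *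
      saTel F r qh t v n y

/-- The operator `G_t^𝒪(a)` for `a = (v, n)`. -/
def Gop (qh k0 u0 k kr ur : Fˣ) (t : Fin r → Fˣ) (v : E r) (n : ℤ) : Module.End F (QA F r) :=
  mkOp F r (Gel F r qh k0 u0 k kr ur t v n)

/-- The twisted action `g_t` of `g ∈ W` on `F[𝒪]`:
`g_t(x^y) = (g_{w₀ y} t)^{-λ} x^{w₀ y}` for `g = τ(λ) w₀`. -/
def Wtw (qh : Fˣ) (t : Fin r → Fˣ) (g : E r → E r) : Module.End F (QA F r) :=
  mkOp F r fun y =>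
    (((upowR F r (torusAct F r qh (gfun r (g y - g 0)) t) (g 0))⁻¹ : Fˣ) : F) •
      X F r (g y - g 0)

/-! ### The operators `D_j` -/

/-- The palindromic word `1, …, r-1, r, r-1, …, 1`. -/
def palin : List ℕ :=
  ((List.range (r - 1)).map (· + 1)) ++ [r] ++ ((List.range (r - 1)).map (· + 1)).reverse

/-- Multiplication by `x^{-ε₁}`. -/
def Mop : Module.End F (QA F r) := mkOp F r fun y => X F r ((-1 : ℝ) • epsV r 1) * X F r y

/-- `D₀ = (T₁^𝒪 ⋯ T_{r-1}^𝒪 T_r^𝒪 T_{r-1}^𝒪 ⋯ T₁^𝒪)⁻¹ ∘ M`. -/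
def D0op (qh : Fˣ) (k0 u0 k kr ur : F) (t : Fin r → Fˣ) : Module.End F (QA F r) :=
  ((palin r).map (TfullInv F r qh k0 u0 k kr ur t)).prod * Mop F r

/-- `D_j`: `D₀` for `j = 0` and `T_j^𝒪` for `1 ≤ j ≤ r`. -/
def Dop (qh : Fˣ) (k0 u0 k kr ur : F) (t : Fin r → Fˣ) (j : ℕ) : Module.End F (QA F r) :=
  if j = 0 then D0op F r qh k0 u0 k kr ur t else Tfull F r qh k0 u0 k kr ur t j

/-- Iterated application `D_{j₁}(D_{j₂}(⋯(D_{j_ℓ}(f))⋯))`. -/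
def applyD (qh : Fˣ) (k0 u0 k kr ur : F) (t : Fin r → Fˣ) (l : List ℕ) (f : QA F r) : QA F r :=
  l.foldr (fun j g => Dop F r qh k0 u0 k kr ur t j g) f

/-- The coefficients `k_{s_j}(y)`. -/
def ksj (k kr ur : Fˣ) (j : ℕ) (y : E r) : Fˣ :=
  if j = 0 then
    kr ^ (-etaE (2 * cd r y 1)) * ur ^ (-etaO (2 * cd r y 1)) *
      ∏ m : Fin r,
        (if 1 ≤ (m : ℕ) then k ^ (-eta (cd r y 1 - y m) - eta (cd r y 1 + y m)) else 1)
  else if j = r then kr ^ (-etaE (2 * cd r y r)) * ur ^ (-etaO (2 * cd r y r))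
  else k ^ (-eta (cd r y j - cd r y (j + 1)))

/-- `k_w(c) = ∏_m k_{s_{j_m}}(s_{j_{m+1}} ⋯ s_{j_ℓ} c)` for the word `w = s_{j₁} ⋯ s_{j_ℓ}`. -/
def kword (k kr ur : Fˣ) (l : List ℕ) (z : E r) : Fˣ :=
  (l.foldr (fun j p => (genF r j p.1, ksj F r k kr ur j p.1 * p.2)) (z, (1 : Fˣ))).2


section Helpers

/-! ### PART A : generators, roots -/

theorem cd_succ (y : E r) (m : Fin r) : cd r y ((m : ℕ) + 1) = y m := by
  unfold cd
  rw [Finset.sum_eq_single m]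
  · simp
  · intro b _ hb
    rw [if_neg]
    intro h
    exact hb (Fin.ext (by omega))
  · simp

theorem genF_zero (y : E r) (m : Fin r) :
    genF r 0 y m = if (m : ℕ) = 0 then 1 - y m else y m := by
  simp [genF]

theorem genF_last (hr : 2 ≤ r) (y : E r) (m : Fin r) :
    genF r r y m = if (m : ℕ) + 1 = r then - y m else y m := by
  have : r ≠ 0 := by omega
  simp [genF, sW, this]

theorem genF_mid (j : ℕ) (hj : j + 1 < r) (y : E r) (m : Fin r) :
    genF r (j+1) y m = y (Equiv.swap (⟨j, by omega⟩ : Fin r) ⟨j+1, hj⟩ m) := by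
  have h1 : j + 1 ≠ r := by omega
  have e1 : cd r y (j+1) = y ⟨j, by omega⟩ := cd_succ r y ⟨j, by omega⟩
  have e2 : cd r y (j+1+1) = y ⟨j+1, by omega⟩ := cd_succ r y ⟨j+1, by omega⟩
  simp only [genF, sW, if_neg h1, Nat.succ_ne_zero, if_false, e1, e2, Equiv.swap_apply_def]
  by_cases hm : (m : ℕ) = j
  · simp [hm, Fin.ext_iff]
  · by_cases hm' : (m : ℕ) = j + 1
    · simp [hm', Fin.ext_iff]
    · simp [hm, hm', Fin.ext_iff]

/-- case split on generators -/
theorem gen_cases (j : ℕ) (hj : j ≤ r) : j = 0 ∨ j = r ∨ ∃ i, j = i + 1 ∧ i + 1 < r := by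
  rcases j with _ | i
  · left; rfl
  · right
    by_cases h : i + 1 = r
    · left; exact h
    · right; exact ⟨i, rfl, by omega⟩

theorem genF_invol (hr : 2 ≤ r) (j : ℕ) (hj : j ≤ r) (y : E r) :
    genF r j (genF r j y) = y := by
  funext m
  rcases gen_cases r j hj with rfl | rfl | ⟨i, rfl, hi⟩
  · simp only [genF_zero]; split_ifs <;> ring
  · simp only [genF_last _ hr]; split_ifs <;> ring
  · simp only [genF_mid _ _ hi, Equiv.swap_apply_self]

/-- Signed affine permutations. -/
def IsForm (w : E r → E r) (σ : Equiv.Perm (Fin r)) (ε lam : Fin r → ℤ) : Prop :=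
  (∀ m, ε m = 1 ∨ ε m = -1) ∧ ∀ z m, w z m = lam m + ε m * z (σ m)

theorem gen_form (hr : 2 ≤ r) (j : ℕ) (hj : j ≤ r) :
    ∃ σ ε lam, IsForm r (genF r j) σ ε lam := by
  rcases gen_cases r j hj with rfl | rfl | ⟨i, rfl, hi⟩
  · refine ⟨1, fun m => if (m : ℕ) = 0 then -1 else 1, fun m => if (m : ℕ) = 0 then 1 else 0,
      ?_, ?_⟩
    · intro m; dsimp only; split_ifs <;> simp
    · intro z m; rw [genF_zero]
      by_cases hm : (m : ℕ) = 0
      · simp [hm]; ring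
      · simp [hm]
  · refine ⟨1, fun m => if (m : ℕ) + 1 = j then -1 else 1, fun m => 0,
      ?_, ?_⟩
    · intro m; dsimp only; split_ifs <;> simp
    · intro z m; rw [genF_last _ hr]
      by_cases hm : (m : ℕ) + 1 = j
      · simp [hm]
      · simp [hm]
  · refine ⟨Equiv.swap (⟨i, by omega⟩ : Fin r) ⟨i+1, hi⟩, fun m => 1, fun m => 0, ?_, ?_⟩
    · simp
    · intro z m; rw [genF_mid _ _ hi]; simp

theorem word_form (hr : 2 ≤ r) (l : List ℕ) (hl : ∀ a ∈ l, a ≤ r) :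
    ∃ σ ε lam, IsForm r (wordAct r l) σ ε lam := by
  induction l with
  | nil => exact ⟨1, fun _ => 1, fun _ => 0, by simp, by simp [wordAct]⟩
  | cons j l ih =>
    obtain ⟨σ, ε, lam, h1, h2⟩ := ih (fun a ha => hl a (by simp [ha]))
    obtain ⟨σ', ε', lam', h1', h2'⟩ := gen_form r hr j (hl j (by simp))
    refine ⟨σ'.trans σ, fun m => ε' m * ε (σ' m), fun m => lam' m + ε' m * lam (σ' m), ?_, ?_⟩
    · intro m
      rcases h1' m with h | h <;> rcases h1 (σ' m) with h' | h' <;> simp [h, h']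
    · intro z m
      change genF r j (wordAct r l z) m = _
      rw [h2', h2]
      push_cast
      simp only [Equiv.trans_apply]
      ring

theorem word_cons (j : ℕ) (l : List ℕ) (z : E r) :
    wordAct r (j :: l) z = genF r j (wordAct r l z) := rfl

theorem word_append (l l' : List ℕ) (z : E r) :
    wordAct r (l ++ l') z = wordAct r l (wordAct r l' z) := by
  simp [wordAct]

theorem word_rev (hr : 2 ≤ r) (l : List ℕ) (hl : ∀ a ∈ l, a ≤ r) (z : E r) :
    wordAct r l.reverse (wordAct r l z) = z := by
  induction l with
  | nil => rfl
  | cons j l ih =>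
    rw [List.reverse_cons, word_append, word_cons]
    change wordAct r l.reverse (genF r j (genF r j _)) = z
    rw [genF_invol r hr j (hl j (by simp))]
    exact ih (fun a ha => hl a (by simp [ha]))

theorem word_rev' (hr : 2 ≤ r) (l : List ℕ) (hl : ∀ a ∈ l, a ≤ r) (z : E r) :
    wordAct r l (wordAct r l.reverse z) = z := by
  have := word_rev r hr l.reverse (by simpa using hl) z
  simpa using this

/-- Explicit affine roots. -/
structure Rt where
  i : Fin r
  j : Fin r
  a : ℤ
  b : ℤ
  n : ℤ
  ha : a = 1 ∨ a = -1
  hb : b = 1 ∨ b = -1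
  hij : i = j → a = b

variable {r}

/-- value of an affine root -/
def Rt.fn (D : Rt r) (y : E r) : ℝ := D.a * y D.i + D.b * y D.j + D.n

/-- coroot vector -/
def Rt.co (D : Rt r) (m : Fin r) : ℝ :=
  if D.i = D.j then (if m = D.i then (D.a : ℝ) else 0)
  else (if m = D.i then (D.a : ℝ) else 0) + (if m = D.j then (D.b : ℝ) else 0)

/-- reflection -/
def Rt.R (D : Rt r) (y : E r) : E r := fun m => y m - D.fn y * D.co m

/-- negative root -/
def Rt.neg (D : Rt r) : Rt r :=
  ⟨D.i, D.j, -D.a, -D.b, -D.n, by rcases D.ha with h | h <;> simp [h],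
    by rcases D.hb with h | h <;> simp [h], fun h => by rw [D.hij h]⟩

/-- the swapped presentation -/
def Rt.swp (D : Rt r) : Rt r :=
  ⟨D.j, D.i, D.b, D.a, D.n, D.hb, D.ha, fun h => (D.hij h.symm).symm⟩

theorem Rt.neg_fn (D : Rt r) (y : E r) : D.neg.fn y = - D.fn y := by
  simp [Rt.neg, Rt.fn]; ring

theorem Rt.neg_R (D : Rt r) (y : E r) : D.neg.R y = D.R y := by
  funext m
  have : D.neg.co m = - D.co m := by
    obtain ⟨p, q, a, b, n, ha, hb, hpq⟩ := D
    simp only [Rt.neg, Rt.co]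
    by_cases h : p = q
    · by_cases hm : m = q <;> simp [h, hm]
    · simp only [if_neg h]
      by_cases hm : m = p
      · subst hm; simp [h]
      · by_cases hm' : m = q <;> simp [hm, hm']
        simp [h, Ne.symm h]
  simp only [Rt.R, Rt.neg_fn, this]; ring

theorem Rt.swp_fn (D : Rt r) (y : E r) : D.swp.fn y = D.fn y := by
  simp [Rt.swp, Rt.fn]; ring

theorem Rt.swp_R (D : Rt r) (y : E r) : D.swp.R y = D.R y := by
  funext m
  have : D.swp.co m = D.co m := by
    obtain ⟨p, q, a, b, n, ha, hb, hpq⟩ := D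
    simp only [Rt.swp, Rt.co]
    by_cases h : p = q
    · have := hpq h
      subst h; subst this; rfl
    · have h' : ¬ q = p := Ne.symm h
      simp only [if_neg h]
      simp only [h', if_false]
      by_cases hm : m = p <;> by_cases hm' : m = q <;> simp [h, h', hm, hm']
  simp only [Rt.R, Rt.swp_fn, this]

theorem form_act {w : E r → E r} {σ : Equiv.Perm (Fin r)} {ε lam : Fin r → ℤ}
    (h : IsForm r w σ ε lam) (D : Rt r) :
    ∃ D' : Rt r, (∀ z, D'.fn z = D.fn (w z)) ∧ ∀ z, w (D'.R z) = D.R (w z) := by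
  obtain ⟨h1, h2⟩ := h
  let D' : Rt r := ⟨σ D.i, σ D.j, D.a * ε D.i, D.b * ε D.j, D.n + D.a * lam D.i + D.b * lam D.j,
    by rcases D.ha with h | h <;> rcases h1 D.i with h' | h' <;> simp [h, h'],
    by rcases D.hb with h | h <;> rcases h1 D.j with h' | h' <;> simp [h, h'],
    fun h => by have h := σ.injective h; rw [D.hij h, h]⟩
  have hf : ∀ z, D'.fn z = D.fn (w z) := by
    intro z
    simp only [Rt.fn, h2, D']
    push_cast; ring
  refine ⟨D', hf, ?_⟩
  intro z
  funext m
  rw [h2]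
  simp only [Rt.R, hf, h2]
  have : D'.co (σ m) = ε m * D.co m := by
    simp only [Rt.co, D', σ.injective.eq_iff]
    have hsq : ∀ p, (ε p : ℝ) * ε p = 1 := by
      intro p; rcases h1 p with h' | h' <;> simp [h']
    by_cases hi : D.i = D.j
    · simp only [if_pos hi]
      by_cases hm : m = D.i
      · simp [hm]; ring
      · simp [hm]
    · simp only [if_neg hi]
      by_cases hm : m = D.i
      · subst hm; simp [hi]; ring
      · by_cases hm' : m = D.j
        · subst hm'; simp [hm]; ring
        · simp [hm, hm']
  rw [this]
  have hsq : (ε m : ℝ) * ε m = 1 := by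
      rcases h1 m with h' | h' <;> simp [h']
  linear_combination (- D.fn (w z) * D.co m) * hsq

theorem word_act (hr : 2 ≤ r) (l : List ℕ) (hl : ∀ a ∈ l, a ≤ r) (D : Rt r) :
    ∃ D' : Rt r, (∀ z, D'.fn z = D.fn (wordAct r l z)) ∧
      ∀ z, wordAct r l (D'.R z) = D.R (wordAct r l z) := by
  obtain ⟨σ, ε, lam, h⟩ := word_form r hr l hl
  exact form_act h D

theorem gen_act (hr : 2 ≤ r) (j : ℕ) (hj : j ≤ r) (D : Rt r) :
    ∃ D' : Rt r, (∀ z, D'.fn z = D.fn (genF r j z)) ∧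
      ∀ z, genF r j (D'.R z) = D.R (genF r j z) := by
  obtain ⟨σ, ε, lam, h⟩ := gen_form r hr j hj
  exact form_act h D

variable (r) in
/-- interior point of the alcove -/
def rho : E r := fun m => ((r : ℝ) - (m : ℕ)) / (2 * (r + 1))

theorem rho_pos (m : Fin r) : 0 < rho r m := by
  have : ((m : ℕ) : ℝ) < r := by exact_mod_cast m.2
  unfold rho
  apply div_pos <;> [linarith; positivity]

theorem rho_lt (m : Fin r) : rho r m < 1 / 2 := by
  have : (0 : ℝ) ≤ ((m : ℕ) : ℝ) := by positivity
  unfold rho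
  rw [div_lt_div_iff₀ (by positivity) (by norm_num)]
  linarith

theorem rho_anti {i j : Fin r} (h : i < j) : rho r j < rho r i := by
  have : ((i : ℕ) : ℝ) < ((j : ℕ) : ℝ) := by exact_mod_cast h
  unfold rho
  apply div_lt_div_of_pos_right _ (by positivity)
  linarith

theorem rho_mem : rho r ∈ CplusCl r := by
  refine ⟨?_, fun m => ⟨(rho_pos m).le, (rho_lt m).le⟩⟩
  intro i j hij
  rcases hij.eq_or_lt with rfl | h
  · exact le_rfl
  · exact (rho_anti h).le

theorem int_cases (n : ℤ) : (1 : ℝ) ≤ n ∨ n = 0 ∨ (n : ℝ) ≤ -1 := by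
  rcases lt_trichotomy n 0 with h | h | h
  · right; right; exact_mod_cast (by omega : n ≤ -1)
  · right; left; exact h
  · left; exact_mod_cast h

/-- every root has constant sign on the closed alcove -/
theorem Rt.sign (D : Rt r) : (0 < D.fn (rho r) ∧ ∀ c ∈ CplusCl r, 0 ≤ D.fn c) ∨
    (D.fn (rho r) < 0 ∧ ∀ c ∈ CplusCl r, D.fn c ≤ 0) := by
  have key : ∀ D : Rt r, D.a = 1 → (0 < D.fn (rho r) ∧ ∀ c ∈ CplusCl r, 0 ≤ D.fn c) ∨
      (D.fn (rho r) < 0 ∧ ∀ c ∈ CplusCl r, D.fn c ≤ 0) := by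
    intro D ha
    have p1 := rho_pos D.i
    have p2 := rho_lt D.i
    have p3 := rho_pos D.j
    have p4 := rho_lt D.j
    rcases D.hb with hb | hb
    · simp only [Rt.fn, ha, hb, Int.cast_one, one_mul]
      rcases int_cases D.n with h | h | h
      · left; exact ⟨by linarith, fun c hc => by linarith [(hc.2 D.i).1, (hc.2 D.j).1]⟩
      · left; rw [h]; push_cast
        exact ⟨by linarith, fun c hc => by linarith [(hc.2 D.i).1, (hc.2 D.j).1]⟩
      · right; exact ⟨by linarith, fun c hc => by linarith [(hc.2 D.i).2, (hc.2 D.j).2]⟩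
    · simp only [Rt.fn, ha, hb, Int.cast_one, one_mul, Int.cast_neg, neg_mul]
      rcases int_cases D.n with h | h | h
      · left; exact ⟨by linarith, fun c hc => by linarith [(hc.2 D.i).1, (hc.2 D.j).2]⟩
      · rw [h]; push_cast
        rcases lt_trichotomy D.i D.j with h' | h' | h'
        · left; exact ⟨by linarith [rho_anti h'], fun c hc => by linarith [hc.1 _ _ h'.le]⟩
        · have := D.hij h'; rw [ha, hb] at this; norm_num at this
        · right; exact ⟨by linarith [rho_anti h'], fun c hc => by linarith [hc.1 _ _ h'.le]⟩
      · right; exact ⟨by linarith, fun c hc => by linarith [(hc.2 D.i).2, (hc.2 D.j).1]⟩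
  rcases D.ha with h | h
  · exact key D h
  · have := key D.neg (by simp [Rt.neg, h])
    simp only [Rt.neg_fn] at this
    rcases this with ⟨h1, h2⟩ | ⟨h1, h2⟩
    · right; exact ⟨by linarith, fun c hc => by linarith [h2 c hc]⟩
    · left; exact ⟨by linarith, fun c hc => by linarith [h2 c hc]⟩

variable (r) in
/-- vertices of the alcove -/
def vtx (s : ℕ) : E r := fun m => if (m : ℕ) < s then 1 / 2 else 0

theorem vtx_mem (s : ℕ) : vtx r s ∈ CplusCl r := by
  refine ⟨?_, ?_⟩
  · intro i j hij
    have : (i : ℕ) ≤ j := hij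
    simp only [vtx]; split_ifs <;> first | omega | norm_num
  · intro m; simp only [vtx]; split_ifs <;> norm_num

theorem vtx_fix (hr : 2 ≤ r) (j : ℕ) (hj : j ≤ r) (s : ℕ) (hs : s ≠ j) (hsr : s ≤ r) :
    genF r j (vtx r s) = vtx r s := by
  funext m
  have hm := m.2
  rcases gen_cases r j hj with rfl | rfl | ⟨i, rfl, hi⟩
  · simp only [genF_zero, vtx]; split_ifs <;> first | omega | norm_num
  · simp only [genF_last _ hr, vtx]; split_ifs <;> first | omega | norm_num
  · simp only [genF_mid _ _ hi, vtx, Equiv.swap_apply_def]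
    split_ifs <;> simp_all [Fin.ext_iff] <;> omega

theorem pm_half {a n : ℤ} (ha : a = 1 ∨ a = -1) (h : (a : ℝ) / 2 + n = 0) : False := by
  have h2 : (a : ℝ) + 2 * n = 0 := by linarith
  have h3 : a + 2 * n = 0 := by exact_mod_cast h2
  omega

theorem simple_aux (hr : 2 ≤ r) (j : ℕ) (hj : j ≤ r) (D : Rt r) (hle : D.i ≤ D.j)
    (h1 : 0 < D.fn (rho r)) (hv : ∀ s ≤ r, s ≠ j → D.fn (vtx r s) = 0) :
    ∀ y, D.R y = genF r j y := by
  obtain ⟨p, q, a, b, n, ha, hb, hpq⟩ := D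
  simp only at hle
  simp only [Rt.fn] at h1
  have hv' : ∀ s ≤ r, s ≠ j → (a : ℝ) * (if (p : ℕ) < s then 1 / 2 else 0) +
    b * (if (q : ℕ) < s then 1 / 2 else 0) + n = 0 := by
    intro s hs hsj
    exact hv s hs hsj
  have hp := p.2
  have hq := q.2
  have hle' : (p : ℕ) ≤ q := hle
  have rp := rho_pos p
  have rp' := rho_lt p
  rcases gen_cases r j hj with rfl | rfl | ⟨i, rfl, hi⟩
  · -- j = 0
    have e := hv' r le_rfl (by omega)
    rw [if_pos hp, if_pos hq] at e
    have hpq' : p = q := by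
      by_contra hne
      have hne' : (p : ℕ) ≠ q := fun h => hne (Fin.ext h)
      have e := hv' (p + 1) (by omega) (by omega)
      rw [if_pos (by omega), if_neg (by omega)] at e
      exact pm_half (n := n) ha (by linarith)
    subst hpq'
    have hab := hpq rfl
    subst hab
    have hn : (n : ℝ) = -a := by linarith
    have hp0 : (p : ℕ) = 0 := by
      by_contra hp0
      have e := hv' p (by omega) hp0
      rw [if_neg (by omega)] at e
      have : (a : ℝ) = 0 := by linarith
      rcases ha with h | h <;> rw [h] at this <;> norm_num at this
    have ha1 : a = -1 := by
      rcases ha with h | h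
      · subst h; rw [hn] at h1; push_cast at h1; linarith
      · exact h
    subst ha1
    intro y
    funext m
    rw [genF_zero]
    simp only [Rt.R, Rt.fn, Rt.co, if_true, hn]
    by_cases hm : m = p
    · subst hm; simp [hp0]; ring
    · have : (m : ℕ) ≠ 0 := fun h => hm (Fin.ext (by omega))
      simp [hm, this]
  · -- j = r
    have hn := hv' 0 (by omega) (by omega)
    simp only [Nat.not_lt_zero, if_false, mul_zero, zero_add] at hn
    have hpq' : p = q := by
      by_contra hne
      have hne' : (p : ℕ) ≠ q := fun h => hne (Fin.ext h)
      have e := hv' (p + 1) (by omega) (by omega)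
      rw [if_pos (by omega), if_neg (by omega)] at e
      exact pm_half (n := n) ha (by linarith)
    subst hpq'
    have hab := hpq rfl
    subst hab
    have hp0 : (p : ℕ) + 1 = j := by
      by_contra hp0
      have e := hv' (p + 1) (by omega) hp0
      rw [if_pos (by omega)] at e
      have : (a : ℝ) = 0 := by linarith
      rcases ha with h | h <;> rw [h] at this <;> norm_num at this
    have ha1 : a = 1 := by
      rcases ha with h | h
      · exact h
      · subst h; rw [hn] at h1; push_cast at h1; linarith
    subst ha1
    intro y
    funext m
    rw [genF_last _ hr]
    simp only [Rt.R, Rt.fn, Rt.co, if_true, hn]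
    by_cases hm : m = p
    · subst hm; simp [hp0]; try ring
    · have : (m : ℕ) + 1 ≠ j := fun h => hm (Fin.ext (by omega))
      simp [hm, this]
  · -- middle
    have hn := hv' 0 (by omega) (by omega)
    simp only [Nat.not_lt_zero, if_false, mul_zero, zero_add] at hn
    have e := hv' r le_rfl (by omega)
    rw [if_pos hp, if_pos hq] at e
    have hba : (b : ℝ) = -a := by linarith
    have hba' : b = -a := by exact_mod_cast hba
    have ha0 : (a : ℝ) ≠ 0 := by rcases ha with h | h <;> rw [h] <;> norm_num
    have hne : (p : ℕ) ≠ q := by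
      intro h
      have := hpq (Fin.ext h)
      omega
    have hp1 : (p : ℕ) = i := by
      by_contra hp1
      have e := hv' (p + 1) (by omega) (by omega)
      rw [if_pos (by omega), if_neg (by omega)] at e
      apply ha0; linarith
    have hq1 : (q : ℕ) = i + 1 := by
      by_contra hq1
      have e := hv' q (by omega) (by omega)
      rw [if_pos (by omega), if_neg (by omega)] at e
      apply ha0; linarith
    have hlt := rho_anti (show p < q by rw [Fin.lt_def]; omega)
    have ha1 : a = 1 := by
      rcases ha with h | h
      · exact h
      · subst h; rw [hn, hba] at h1; push_cast at h1; linarith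
    subst ha1
    have hp2 : p = ⟨i, by omega⟩ := Fin.ext hp1
    have hq2 : q = ⟨i + 1, by omega⟩ := Fin.ext hq1
    intro y
    funext m
    rw [genF_mid _ _ hi, ← hp2, ← hq2]
    have hne2 : p ≠ q := fun h => hne (by rw [h])
    simp only [Rt.R, Rt.fn, Rt.co, hn, hba, if_neg hne2, Equiv.swap_apply_def]
    by_cases hm : m = p
    · subst hm; simp [hne2]
    · by_cases hm' : m = q
      · subst hm'; simp [Ne.symm hne2]
      · simp [hm, hm']

/-- a generator changes the sign of only one positive root -/
theorem simple_only (hr : 2 ≤ r) (j : ℕ) (hj : j ≤ r) (D : Rt r)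
    (h1 : 0 < D.fn (rho r)) (h2 : D.fn (genF r j (rho r)) < 0) :
    ∀ y, D.R y = genF r j y := by
  obtain ⟨D', hD', -⟩ := gen_act hr j hj D
  have hv : ∀ s ≤ r, s ≠ j → D.fn (vtx r s) = 0 := by
    intro s hs hsj
    have a1 : 0 ≤ D.fn (vtx r s) := by
      rcases D.sign with ⟨_, h⟩ | ⟨h, _⟩
      · exact h _ (vtx_mem s)
      · linarith
    have a2 : D'.fn (vtx r s) ≤ 0 := by
      rcases D'.sign with ⟨h, _⟩ | ⟨_, h⟩
      · rw [hD'] at h; linarith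
      · exact h _ (vtx_mem s)
    rw [hD', vtx_fix hr j hj s hsj hs] at a2
    linarith
  rcases le_total D.i D.j with h | h
  · exact simple_aux hr j hj D h h1 hv
  · intro y
    rw [← Rt.swp_R]
    exact simple_aux hr j hj D.swp h (by rw [Rt.swp_fn]; exact h1)
      (fun s hs hsj => by rw [Rt.swp_fn]; exact hv s hs hsj) y

/-- the simple roots exist -/
theorem simple_exists (hr : 2 ≤ r) (j : ℕ) (hj : j ≤ r) :
    ∃ D : Rt r, 0 < D.fn (rho r) ∧ (∀ y, D.fn (genF r j y) = - D.fn y) ∧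
      (∀ y, D.R y = genF r j y) ∧ (∀ y, D.fn y = alphaF r j y) := by
  have main : ∃ D : Rt r, 0 < D.fn (rho r) ∧ (∀ y, D.fn (genF r j y) = - D.fn y) ∧
      (∀ y, D.fn y = alphaF r j y) := by
    rcases gen_cases r j hj with rfl | rfl | ⟨i, rfl, hi⟩
    · refine ⟨⟨⟨0, by omega⟩, ⟨0, by omega⟩, -1, -1, 1, by simp, by simp, fun _ => rfl⟩, ?_, ?_, ?_⟩
      · simp only [Rt.fn]; push_cast; linarith [rho_lt (⟨0, by omega⟩ : Fin r)]
      · intro y; simp only [Rt.fn, genF_zero]; simp; ring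
      · intro y
        have := cd_succ r y ⟨0, by omega⟩
        simp only [zero_add] at this
        simp only [Rt.fn, alphaF, this]; simp; ring
    · refine ⟨⟨⟨j-1, by omega⟩, ⟨j-1, by omega⟩, 1, 1, 0, by simp, by simp, fun _ => rfl⟩, ?_, ?_, ?_⟩
      · simp only [Rt.fn]; push_cast; linarith [rho_pos (⟨j-1, by omega⟩ : Fin j)]
      · intro y; simp only [Rt.fn, genF_last _ hr]; rw [if_pos (by omega)]; push_cast; ring
      · intro y
        have := cd_succ j y ⟨j-1, by omega⟩
        simp only [Nat.sub_add_cancel (show 1 ≤ j by omega)] at this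
        have h0 : j ≠ 0 := by omega
        simp only [Rt.fn, alphaF, this, if_neg h0]; simp; ring
    · refine ⟨⟨⟨i, by omega⟩, ⟨i+1, by omega⟩, 1, -1, 0, by simp, by simp, ?_⟩, ?_, ?_, ?_⟩
      · intro h; simp at h
      · simp only [Rt.fn]; push_cast
        have := rho_anti (show (⟨i, by omega⟩ : Fin r) < ⟨i+1, by omega⟩ by rw [Fin.lt_def]; simp)
        linarith
      · intro y; simp only [Rt.fn, genF_mid _ _ hi]; simp; 
      · intro y
        have e1 := cd_succ r y ⟨i, by omega⟩
        have e2 := cd_succ r y ⟨i+1, by omega⟩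
        simp only at e1 e2
        have h0 : i + 1 ≠ r := by omega
        simp only [Rt.fn, alphaF, e1, e2, if_neg h0]; simp; ring
  obtain ⟨D, h1, h2, h3⟩ := main
  exact ⟨D, h1, h2, simple_only hr j hj D h1 (by rw [h2]; linarith), h3⟩

/-! ### PART B : exchange, uniqueness, Bruhat order -/

theorem exch (hr : 2 ≤ r) (l : List ℕ) (hl : ∀ a ∈ l, a ≤ r) :
    ∀ D : Rt r, 0 < D.fn (rho r) → D.fn (wordAct r l (rho r)) < 0 →
      ∃ l', l'.Sublist l ∧ l'.length + 1 = l.length ∧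
        ∀ z, wordAct r l' z = D.R (wordAct r l z) := by
  induction l with
  | nil => intro D h1 h2; exact absurd h1 (not_lt.2 (le_of_lt h2))
  | cons j l ih =>
    intro D h1 h2
    have hj : j ≤ r := hl j (by simp)
    have hl' : ∀ a ∈ l, a ≤ r := fun a ha => hl a (by simp [ha])
    rw [word_cons] at h2
    obtain ⟨D', hD', hR'⟩ := gen_act hr j hj D
    rcases D'.sign with ⟨h, _⟩ | ⟨h, _⟩
    · obtain ⟨l', s1, s2, s3⟩ := ih hl' D' h (by rw [hD']; exact h2)
      refine ⟨j :: l', s1.cons_cons j, by simp [s2], ?_⟩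
      intro z
      rw [word_cons, s3, hR', word_cons]
    · rw [hD'] at h
      refine ⟨l, List.sublist_cons_self j l, by simp, ?_⟩
      intro z
      rw [simple_only hr j hj D h1 h, word_cons, genF_invol r hr j hj]

theorem exch_neg (hr : 2 ≤ r) (l : List ℕ) (hl : ∀ a ∈ l, a ≤ r) (D : Rt r)
    (h1 : D.fn (rho r) < 0) (h2 : 0 < D.fn (wordAct r l (rho r))) :
      ∃ l', l'.Sublist l ∧ l'.length + 1 = l.length ∧
        ∀ z, wordAct r l' z = D.R (wordAct r l z) := by
  obtain ⟨l', s1, s2, s3⟩ := exch hr l hl D.neg (by rw [Rt.neg_fn]; linarith)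
    (by rw [Rt.neg_fn]; linarith)
  exact ⟨l', s1, s2, fun z => by rw [s3, Rt.neg_R]⟩

/-- roots do not vanish on the orbit of rho -/
theorem fn_word_ne (hr : 2 ≤ r) (l : List ℕ) (hl : ∀ a ∈ l, a ≤ r) (D : Rt r) :
    D.fn (wordAct r l (rho r)) ≠ 0 := by
  obtain ⟨D', h, -⟩ := word_act hr l hl D
  rw [← h]
  rcases D'.sign with h | h
  · exact h.1.ne'
  · exact h.1.ne

theorem fn_word_pos (hr : 2 ≤ r) (l : List ℕ) (hl : ∀ a ∈ l, a ≤ r) (D : Rt r) (c : E r)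
    (hc : c ∈ CplusCl r) (h : 0 < D.fn (wordAct r l c)) : 0 < D.fn (wordAct r l (rho r)) := by
  obtain ⟨D', h', -⟩ := word_act hr l hl D
  rw [← h'] at h ⊢
  rcases D'.sign with h2 | h2
  · exact h2.1
  · linarith [h2.2 c hc]

theorem fn_word_neg (hr : 2 ≤ r) (l : List ℕ) (hl : ∀ a ∈ l, a ≤ r) (D : Rt r) (c : E r)
    (hc : c ∈ CplusCl r) (h : D.fn (wordAct r l c) < 0) : D.fn (wordAct r l (rho r)) < 0 := by
  obtain ⟨D', h', -⟩ := word_act hr l hl D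
  rw [← h'] at h ⊢
  rcases D'.sign with h2 | h2
  · linarith [h2.2 c hc]
  · exact h2.1

/-- words which stay in the fundamental chamber act trivially -/
theorem word_trivial (hr : 2 ≤ r) : ∀ (N : ℕ) (l : List ℕ), l.length ≤ N → (∀ a ∈ l, a ≤ r) →
    (∀ D : Rt r, 0 < D.fn (rho r) → 0 < D.fn (wordAct r l (rho r))) →
    ∀ z, wordAct r l z = z := by
  intro N
  induction N with
  | zero =>
    intro l h0 _ _ z
    have : l = [] := List.length_eq_zero_iff.1 (by omega)
    subst this; rfl
  | succ N ih =>
    intro l h0 hl hD z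
    rcases l with _ | ⟨j, l⟩
    · rfl
    have hj : j ≤ r := hl j (by simp)
    have hl' : ∀ a ∈ l, a ≤ r := fun a ha => hl a (by simp [ha])
    obtain ⟨D, d1, d2, d3, -⟩ := simple_exists hr j hj
    have h1 := hD D d1
    rw [word_cons, d2] at h1
    obtain ⟨l', s1, s2, s3⟩ := exch hr l hl' D d1 (by linarith)
    have e : ∀ z, wordAct r l' z = wordAct r (j :: l) z := by
      intro z; rw [s3, d3, word_cons]
    rw [← e]
    apply ih l' (by simp at h0; omega) (fun a ha => hl' a (s1.subset ha))
    intro D hDp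
    rw [e]
    exact hD D hDp

/-- two words in the same chamber agree -/
theorem word_eq_of_sign (hr : 2 ≤ r) (l m : List ℕ) (hl : ∀ a ∈ l, a ≤ r) (hm : ∀ a ∈ m, a ≤ r)
    (h : ∀ D : Rt r, 0 < D.fn (wordAct r l (rho r)) → 0 < D.fn (wordAct r m (rho r))) :
    ∀ z, wordAct r l z = wordAct r m z := by
  have hlr : ∀ a ∈ l.reverse, a ≤ r := by simpa using hl
  have hlm : ∀ a ∈ l.reverse ++ m, a ≤ r := by
    intro a ha
    rcases List.mem_append.1 ha with h | h
    · exact hlr a h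
    · exact hm a h
  have key := word_trivial hr _ (l.reverse ++ m) le_rfl hlm (by
    intro D hD
    obtain ⟨D', hD', -⟩ := word_act hr l.reverse hlr D
    rw [word_append, ← hD']
    apply h
    rw [hD', word_rev r hr l hl]
    exact hD)
  intro z
  have := key z
  rw [word_append] at this
  conv_lhs => rw [← this]
  rw [word_rev' r hr l hl]

/-- irredundant words for the point `c` -/
def Irr (l : List ℕ) (c : E r) : Prop :=
  ∀ l', l'.Sublist l → wordAct r l' c = wordAct r l c → l.length ≤ l'.length

theorem irr_sep (hr : 2 ≤ r) (l : List ℕ) (hl : ∀ a ∈ l, a ≤ r) (c : E r) (hc : c ∈ CplusCl r)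
    (hi : Irr l c) (D : Rt r) (h1 : 0 < D.fn (rho r)) (h2 : D.fn (wordAct r l (rho r)) < 0) :
    D.fn (wordAct r l c) < 0 := by
  obtain ⟨l', s1, s2, s3⟩ := exch hr l hl D h1 h2
  rcases lt_trichotomy (D.fn (wordAct r l c)) 0 with h | h | h
  · exact h
  · exfalso
    have : wordAct r l' c = wordAct r l c := by
      rw [s3]; funext m; simp [Rt.R, h]
    have := hi l' s1 this
    omega
  · have := fn_word_pos hr l hl D c hc h
    linarith

theorem irr_unique (hr : 2 ≤ r) (l m : List ℕ) (hl : ∀ a ∈ l, a ≤ r) (hm : ∀ a ∈ m, a ≤ r)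
    (c d : E r) (hc : c ∈ CplusCl r) (hd : d ∈ CplusCl r) (hil : Irr l c) (him : Irr m d)
    (h : wordAct r l c = wordAct r m d) : ∀ z, wordAct r l z = wordAct r m z := by
  apply word_eq_of_sign hr l m hl hm
  intro D hD
  by_contra hcon
  have hneg : D.fn (wordAct r m (rho r)) < 0 :=
    lt_of_le_of_ne (not_lt.1 hcon) (fn_word_ne hr m hm D)
  rcases D.sign with ⟨h1, _⟩ | ⟨h1, _⟩
  · have := irr_sep hr m hm d hd him D h1 hneg
    rw [← h] at this
    have := fn_word_neg hr l hl D c hc this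
    linarith
  · have := irr_sep hr l hl c hc hil D.neg (by rw [Rt.neg_fn]; linarith)
      (by rw [Rt.neg_fn]; linarith)
    rw [Rt.neg_fn, h] at this
    have := fn_word_pos hr m hm D d hd (by linarith)
    linarith

theorem exists_irr (l : List ℕ) (c : E r) :
    ∃ l', l'.Sublist l ∧ wordAct r l' c = wordAct r l c ∧ Irr l' c := by
  have hex : ∃ N, ∃ l', l'.Sublist l ∧ wordAct r l' c = wordAct r l c ∧ l'.length = N :=
    ⟨_, l, List.Sublist.refl l, rfl, rfl⟩
  obtain ⟨l', h1, h2, h3⟩ := Nat.find_spec hex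
  refine ⟨l', h1, h2, ?_⟩
  intro l'' g1 g2
  rw [h3]
  exact Nat.find_min' hex ⟨l'', g1.trans h1, g2.trans h2, rfl⟩

/-- irredundant words are reduced -/
theorem irr_reduced (hr : 2 ≤ r) (l : List ℕ) (hl : ∀ a ∈ l, a ≤ r) (c : E r)
    (hi : Irr l c) : ∀ m : List ℕ, (∀ a ∈ m, a ≤ r) → (∀ z, wordAct r m z = wordAct r l z) →
      l.length ≤ m.length := by
  induction l generalizing c with
  | nil => intro m _ _; simp
  | cons j l ih =>
    intro m hm hml
    have hj : j ≤ r := hl j (by simp)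
    have hl' : ∀ a ∈ l, a ≤ r := fun a ha => hl a (by simp [ha])
    obtain ⟨D, d1, d2, d3, -⟩ := simple_exists hr j hj
    have hpos : 0 < D.fn (wordAct r l (rho r)) := by
      by_contra hcon
      have hneg : D.fn (wordAct r l (rho r)) < 0 :=
        lt_of_le_of_ne (not_lt.1 hcon) (fn_word_ne hr l hl' D)
      obtain ⟨l', s1, s2, s3⟩ := exch hr l hl' D d1 hneg
      have := hi l' (s1.trans (List.sublist_cons_self j l)) (by rw [s3, d3, word_cons])
      simp at this; omega
    have hirr : Irr l c := by
      intro l' s1 s2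
      have := hi (j :: l') (s1.cons_cons j) (by rw [word_cons, s2, word_cons])
      simpa using this
    have hmneg : D.fn (wordAct r m (rho r)) < 0 := by
      rw [hml, word_cons, d2]; linarith
    obtain ⟨m', s1, s2, s3⟩ := exch hr m hm D d1 hmneg
    have := ih hl' c hirr m' (fun a ha => hm a (s1.subset ha)) (by
      intro z; rw [s3, d3, hml, word_cons, genF_invol r hr j hj])
    simp; omega

theorem irr_wlen (hr : 2 ≤ r) (l : List ℕ) (hl : ∀ a ∈ l, a ≤ r) (c : E r)
    (hi : Irr l c) (g : E r → E r) (hg : ∀ z, wordAct r l z = g z) : l.length = wlen r g := by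
  unfold wlen
  apply le_antisymm
  · apply le_csInf
    · exact ⟨l.length, l, hl, rfl, funext hg⟩
    · rintro n ⟨m, hm, rfl, hmg⟩
      apply irr_reduced hr l hl c hi m hm
      intro z
      rw [hg, ← hmg]
  · exact Nat.sInf_le ⟨l, hl, rfl, funext hg⟩

/-- fundamental domain : uniqueness -/
theorem alcove_unique (hr : 2 ≤ r) (l : List ℕ) (hl : ∀ a ∈ l, a ≤ r) (c : E r)
    (hc : c ∈ CplusCl r) (hd : wordAct r l c ∈ CplusCl r) : wordAct r l c = c := by
  obtain ⟨l', s1, s2, s3⟩ := exists_irr l c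
  have hl' : ∀ a ∈ l', a ≤ r := fun a ha => hl a (s1.subset ha)
  have hnil : Irr ([] : List ℕ) (wordAct r l c) := by intro l' _ _; simp
  have := irr_unique hr l' [] hl' (by simp) c (wordAct r l c) hc hd s3 hnil (by rw [s2]; rfl) c
  rw [s2] at this
  exact this

/-- fundamental domain : existence -/
theorem mem_alcove_of_alpha (hr : 2 ≤ r) (z : E r) (h : ∀ j ≤ r, 0 ≤ alphaF r j z) :
    z ∈ CplusCl r := by
  have e : ∀ m : Fin r, cd r z ((m : ℕ) + 1) = z m := cd_succ r z
  have hstep : ∀ i (hi : i + 1 < r), z ⟨i + 1, hi⟩ ≤ z ⟨i, by omega⟩ := by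
    intro i hi
    have := h (i + 1) hi.le
    have h1 := e ⟨i, by omega⟩
    have h2 := e ⟨i + 1, by omega⟩
    simp only at h1 h2
    simp only [alphaF, h1, h2, if_neg (show i + 1 ≠ r by omega)] at this
    simpa using this
  have hanti : ∀ (d i : ℕ) (hi : i + d < r), z ⟨i + d, hi⟩ ≤ z ⟨i, by omega⟩ := by
    intro d
    induction d with
    | zero => intro i hi; exact le_rfl
    | succ d ih =>
      intro i hi
      exact (hstep (i + d) hi).trans (ih i (by omega))
  have hanti' : ∀ i j : Fin r, i ≤ j → z j ≤ z i := by
    intro i j hij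
    have hij' : (i : ℕ) ≤ j := hij
    have := hanti (j - i) i (by omega)
    convert this using 2
    exact Fin.ext (by simp; omega)
  refine ⟨hanti', ?_⟩
  have h0 := h 0 (by omega)
  have e0 := e ⟨0, by omega⟩
  simp only [zero_add] at e0
  simp only [alphaF, if_true, e0] at h0
  have h1 := h r le_rfl
  have e1 := e ⟨r - 1, by omega⟩
  simp only [Nat.sub_add_cancel (show 1 ≤ r by omega)] at e1
  simp only [alphaF, if_neg (show r ≠ 0 by omega), if_true, e1] at h1
  intro m
  have a1 := hanti' ⟨0, by omega⟩ m (by rw [Fin.le_def]; simp)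
  have a2 := hanti' m ⟨r - 1, by omega⟩ (by rw [Fin.le_def]; simp; omega)
  constructor <;> linarith

/-- squared distance to rho -/
def dist2 (z : E r) : ℝ := ∑ m, (z m - rho r m) ^ 2

theorem dist2_refl (D : Rt r) (z : E r) :
    ∃ κ : ℝ, 0 < κ ∧ dist2 (D.R z) = dist2 z + κ * D.fn z * D.fn (rho r) := by
  have hsum : ∀ (f : Fin r → ℝ), dist2 (fun m => z m - f m) =
      dist2 z - 2 * ∑ m, f m * (z m - rho r m) + ∑ m, f m * f m := by
    intro f
    simp only [dist2]
    rw [Finset.mul_sum, ← Finset.sum_sub_distrib, ← Finset.sum_add_distrib]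
    apply Finset.sum_congr rfl
    intro m _; ring
  have ha2 : (D.a : ℝ) * D.a = 1 := by rcases D.ha with h | h <;> simp [h]
  have hb2 : (D.b : ℝ) * D.b = 1 := by rcases D.hb with h | h <;> simp [h]
  have e : D.R z = fun m => z m - D.fn z * D.co m := rfl
  rw [e, hsum]
  have e1 : ∀ g : Fin r → ℝ, ∑ m, D.fn z * D.co m * g m = D.fn z * ∑ m, D.co m * g m := by
    intro g; rw [Finset.mul_sum]; apply Finset.sum_congr rfl; intro m _; ring
  have e2 : ∑ m, D.fn z * D.co m * (D.fn z * D.co m) =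
      D.fn z * (D.fn z * ∑ m, D.co m * D.co m) := by
    rw [Finset.mul_sum, Finset.mul_sum]; apply Finset.sum_congr rfl; intro m _; ring
  rw [e1 (fun m => z m - rho r m), e2]
  by_cases h : D.i = D.j
  · have hab := D.hij h
    have s : ∀ g : Fin r → ℝ, ∑ m, D.co m * g m = D.a * g D.i := by
      intro g; simp [Rt.co, h]
    rw [s, s]
    refine ⟨1, by norm_num, ?_⟩
    have hc : D.co D.i = D.a := by simp [Rt.co, h]
    rw [hc]
    simp only [Rt.fn, ← h, ← hab]
    linear_combination ((D.a * z D.i + D.a * z D.i + D.n) * (D.a * z D.i + D.a * z D.i + D.n)) * ha2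
  · have s : ∀ g : Fin r → ℝ, ∑ m, D.co m * g m = D.a * g D.i + D.b * g D.j := by
      intro g; simp [Rt.co, h, add_mul, Finset.sum_add_distrib]
    rw [s, s]
    refine ⟨2, by norm_num, ?_⟩
    have hc : D.co D.i = D.a := by simp [Rt.co, h]
    have hc' : D.co D.j = D.b := by simp [Rt.co, h, Ne.symm h]
    rw [hc, hc']
    simp only [Rt.fn]
    linear_combination ((D.a * z D.i + D.b * z D.j + D.n) * (D.a * z D.i + D.b * z D.j + D.n)) * (ha2 + hb2)

theorem orbit_finite (hr : 2 ≤ r) (y : E r) (B : ℝ) :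
    {z : E r | z ∈ orbit r y ∧ dist2 z ≤ B}.Finite := by
  obtain ⟨N, hN⟩ := exists_nat_ge (|B| + 2 + ∑ m, |y m|)
  let T : Set ℝ := (fun p : ℤ × ℤ × Fin r => (p.1 : ℝ) + p.2.1 * y p.2.2) ''
    ((Set.Icc (-(N : ℤ)) N) ×ˢ (Set.Icc (-1 : ℤ) 1) ×ˢ (Set.univ : Set (Fin r)))
  have hT : T.Finite := by
    apply Set.Finite.image
    exact (Set.finite_Icc _ _).prod ((Set.finite_Icc _ _).prod Set.finite_univ)
  apply (Set.Finite.pi (fun _ : Fin r => hT)).subset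
  rintro z ⟨⟨l, hl, rfl⟩, hB⟩ m _
  obtain ⟨σ, ε, lam, h1, h2⟩ := word_form r hr l hl
  refine ⟨(lam m, ε m, σ m), ⟨?_, ?_, Set.mem_univ _⟩, (h2 y m).symm⟩
  · have hb1 : (wordAct r l y m - rho r m) ^ 2 ≤ B :=
      le_trans (Finset.single_le_sum (f := fun m => (wordAct r l y m - rho r m) ^ 2)
        (fun i _ => sq_nonneg _) (Finset.mem_univ m)) hB
    have hb2 : |wordAct r l y m - rho r m| ≤ |B| + 1 := by
      rw [abs_le]
      have := le_abs_self B
      have := abs_nonneg B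
      constructor <;> nlinarith
    have hy : |y (σ m)| ≤ ∑ m, |y m| :=
      Finset.single_le_sum (f := fun m => |y m|) (fun i _ => abs_nonneg _) (Finset.mem_univ (σ m))
    have q1 := rho_pos m
    have q2 := rho_lt m
    rw [h2 y m] at hb2
    have hb3 := abs_le.1 hb2
    have hy3 := abs_le.1 hy
    have : (-(N : ℝ)) ≤ lam m ∧ (lam m : ℝ) ≤ N := by
      rcases h1 m with h | h <;> rw [h] at hb3 <;> push_cast at hb3 <;> constructor <;> linarith
    constructor
    · exact_mod_cast this.1
    · exact_mod_cast this.2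
  · rcases h1 m with h | h <;> simp [h]

theorem alcove_exists (hr : 2 ≤ r) (y : E r) :
    ∃ l : List ℕ, (∀ a ∈ l, a ≤ r) ∧ wordAct r l y ∈ CplusCl r := by
  have hne : {z : E r | z ∈ orbit r y ∧ dist2 z ≤ dist2 y}.Nonempty :=
    ⟨y, ⟨[], by simp, rfl⟩, le_rfl⟩
  obtain ⟨z, ⟨⟨l, hl, hlz⟩, hz⟩, hmin⟩ :=
    Set.exists_min_image _ dist2 (orbit_finite hr y (dist2 y)) hne
  refine ⟨l, hl, ?_⟩
  rw [hlz]
  apply mem_alcove_of_alpha hr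
  intro j hj
  obtain ⟨D, d1, d2, d3, d4⟩ := simple_exists hr j hj
  rw [← d4]
  by_contra hcon
  push Not at hcon
  obtain ⟨κ, hκ, hd⟩ := dist2_refl D z
  have hlt : dist2 (D.R z) < dist2 z := by
    rw [hd]
    have := mul_neg_of_neg_of_pos (mul_neg_of_pos_of_neg hκ hcon) d1
    linarith
  have := hmin (D.R z) ⟨⟨j :: l, by
    intro a ha
    rcases List.mem_cons.1 ha with rfl | h
    · exact hj
    · exact hl a h, by rw [word_cons, hlz, d3]⟩, by linarith⟩
  linarith

theorem gW_spec (hr : 2 ≤ r) (y : E r) :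
    (∀ a ∈ gW r y, a ≤ r) ∧ wordAct r (gW r y).reverse y ∈ CplusCl r ∧
      ∀ l' : List ℕ, (∀ a ∈ l', a ≤ r) → wordAct r l'.reverse y ∈ CplusCl r →
        (gW r y).length ≤ l'.length := by
  have h : ∃ l : List ℕ, (∀ a ∈ l, a ≤ r) ∧ wordAct r l.reverse y ∈ CplusCl r ∧
      ∀ l' : List ℕ, (∀ a ∈ l', a ≤ r) → wordAct r l'.reverse y ∈ CplusCl r →
        l.length ≤ l'.length := by
    have hex : ∃ N, ∃ l : List ℕ, (∀ a ∈ l, a ≤ r) ∧ wordAct r l.reverse y ∈ CplusCl r ∧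
        l.length = N := by
      obtain ⟨l, hl, h⟩ := alcove_exists hr y
      exact ⟨_, l.reverse, by simpa using hl, by simpa using h, rfl⟩
    obtain ⟨l, h1, h2, h3⟩ := Nat.find_spec hex
    refine ⟨l, h1, h2, ?_⟩
    intro l' g1 g2
    rw [h3]
    exact Nat.find_min' hex ⟨l', g1, g2, rfl⟩
  unfold gW
  rw [dif_pos h]
  exact h.choose_spec

theorem gW_irr (hr : 2 ≤ r) (y : E r) : Irr (gW r y) (wordAct r (gW r y).reverse y) := by
  obtain ⟨h1, h2, h3⟩ := gW_spec hr y
  intro l' s1 s2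
  have hl' : ∀ a ∈ l', a ≤ r := fun a ha => h1 a (s1.subset ha)
  apply h3 l' hl'
  rw [word_rev' r hr _ h1] at s2
  have := word_rev r hr l' hl' (wordAct r (gW r y).reverse y)
  rw [s2] at this
  rw [this]
  exact h2

/-- key: reflection in a separating hyperplane lowers -/
theorem refl_lt (hr : 2 ≤ r) (y : E r) (D : Rt r)
    (h : (0 < D.fn (rho r) ∧ D.fn y < 0) ∨ (D.fn (rho r) < 0 ∧ 0 < D.fn y)) :
    qlt r (D.R y) y := by
  obtain ⟨h1, h2, h3⟩ := gW_spec hr y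
  have hirr := gW_irr hr y
  set c := wordAct r (gW r y).reverse y with hc
  have hy : wordAct r (gW r y) c = y := word_rev' r hr _ h1 y
  have hex : ∃ l', l'.Sublist (gW r y) ∧ l'.length + 1 = (gW r y).length ∧
        ∀ z, wordAct r l' z = D.R (wordAct r (gW r y) z) := by
    rcases h with ⟨p1, p2⟩ | ⟨p1, p2⟩
    · exact exch hr _ h1 D p1 (fn_word_neg hr _ h1 D c h2 (by rw [hy]; exact p2))
    · exact exch_neg hr _ h1 D p1 (fn_word_pos hr _ h1 D c h2 (by rw [hy]; exact p2))
  obtain ⟨l', s1, -, s3⟩ := hex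
  obtain ⟨l'', t1, t2, t3⟩ := exists_irr l' c
  have hl'' : ∀ a ∈ l'', a ≤ r := fun a ha => h1 a (s1.subset (t1.subset ha))
  have hyc : wordAct r l'' c = D.R y := by rw [t2, s3, hy]
  obtain ⟨g1, g2, g3⟩ := gW_spec hr (D.R y)
  have gi := gW_irr hr (D.R y)
  have heq := irr_unique hr l'' (gW r (D.R y)) hl'' g1 c _ h2 g2 t3 gi
    (by rw [hyc, word_rev' r hr _ g1])
  refine ⟨⟨?_, ?_⟩, ?_⟩
  · refine ⟨l'' ++ (gW r y).reverse, ?_, ?_⟩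
    · intro a ha
      rcases List.mem_append.1 ha with h | h
      · exact hl'' a h
      · exact h1 a (by simpa using h)
    · rw [word_append, ← hc, hyc]
  · refine ⟨gW r y, h1, rfl, irr_wlen hr _ h1 c hirr _ (fun z => rfl), l'', t1.trans s1, ?_, ?_⟩
    · funext z; exact heq z
    · exact irr_wlen hr _ hl'' c t3 _ (fun z => heq z)
  · intro heq
    have hne : D.fn y ≠ 0 := by rcases h with h | h; exacts [h.2.ne, h.2.ne']
    have e := congrFun heq D.i
    simp only [Rt.R] at e
    have e' : D.fn y * D.co D.i = 0 := by linarith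
    rcases mul_eq_zero.1 e' with h | h
    · exact hne h
    · have : D.co D.i = D.a := by
        by_cases h : D.i = D.j <;> simp [Rt.co, h]
      rw [this] at h
      rcases D.ha with h' | h' <;> rw [h'] at h <;> norm_num at h

/-! ### PART C : torus compatibility and triangularity -/

theorem phi_cases (v : E r) (hv : v ∈ PhiPlus r) :
    ∃ (a b : Fin r) (s : ℤ), (s = 1 ∨ s = -1) ∧ a ≤ b ∧ (a = b → s = 1) ∧
      ∀ m, v m = (if m = a then 1 else 0) + s * (if m = b then 1 else 0) := by
  rcases hv with ⟨a, b, hab, rfl⟩ | ⟨a, b, hab, rfl⟩ | ⟨a, rfl⟩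
  · refine ⟨a, b, -1, by simp, hab.le, fun h => absurd h hab.ne, ?_⟩
    intro m; simp only [eV, Pi.sub_apply]; push_cast; ring
  · refine ⟨a, b, 1, by simp, hab.le, fun h => absurd h hab.ne, ?_⟩
    intro m; simp only [eV, Pi.add_apply]; push_cast; ring
  · refine ⟨a, a, 1, by simp, le_rfl, fun _ => rfl, ?_⟩
    intro m; simp only [eV, Pi.smul_apply, smul_eq_mul]; push_cast; ring

theorem ip_of_form {v : E r} {a b : Fin r} {s : ℤ}
    (h : ∀ m, v m = (if m = a then 1 else 0) + s * (if m = b then 1 else 0)) (y : E r) :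
    ip r v y = y a + s * y b := by
  simp only [ip, h, add_mul, Finset.sum_add_distrib, mul_assoc, ← Finset.mul_sum]
  simp

theorem ipvv_of_form {v : E r} {a b : Fin r} {s : ℤ} (hs : s = 1 ∨ s = -1) (hab : a = b → s = 1)
    (h : ∀ m, v m = (if m = a then 1 else 0) + s * (if m = b then 1 else 0)) :
    ip r v v = if a = b then 4 else 2 := by
  rw [ip_of_form h, h, h]
  by_cases e : a = b
  · have := hab e
    subst e; subst this; simp; norm_num
  · have hs2 : (s : ℝ) * s = 1 := by rcases hs with h | h <;> simp [h]
    simp only [if_neg e, if_neg (Ne.symm e), if_true]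
    linarith

theorem coroot_of_form {v : E r} {a b : Fin r} {s : ℤ} (hs : s = 1 ∨ s = -1) (hab : a = b → s = 1)
    (h : ∀ m, v m = (if m = a then 1 else 0) + s * (if m = b then 1 else 0)) (m : Fin r) :
    coroot r v m = if a = b then (if m = a then 1 else 0) else
      (if m = a then 1 else 0) + s * (if m = b then 1 else 0) := by
  simp only [coroot, ipvv_of_form hs hab h, Pi.smul_apply, smul_eq_mul, h]
  by_cases e : a = b
  · have := hab e
    subst e; subst this
    by_cases hm : m = a
    · simp [hm]; norm_num
    · simp [hm]
  · simp only [if_neg e]; norm_num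

theorem refl_mem (hr : 2 ≤ r) (v : E r) (hv : v ∈ PhiPlus r) (y : E r) (N : ℤ)
    (h : (1 ≤ N ∧ (N : ℝ) < ip r v y) ∨ (N ≤ 0 ∧ ip r v y < N)) :
    X F r ((N : ℝ) • coroot r v + sRefl r v y) ∈ ltSpan F r y := by
  obtain ⟨a, b, s, hs, hle, hab, hf⟩ := phi_cases v hv
  let D : Rt r := ⟨a, b, 1, s, -N, by simp, hs, fun h => (hab h).symm⟩
  have hfn : ∀ z, D.fn z = ip r v z - N := by
    intro z; rw [ip_of_form hf]; simp [D, Rt.fn]; ring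
  have hco : ∀ m, D.co m = coroot r v m := by
    intro m; rw [coroot_of_form hs hab hf]
    simp [D, Rt.co]
  have hR : D.R y = (N : ℝ) • coroot r v + sRefl r v y := by
    funext m
    simp only [Rt.R, hfn, hco, sRefl, Pi.add_apply, Pi.smul_apply, Pi.sub_apply, smul_eq_mul]
    ring
  have hrho : 0 < ip r v (rho r) ∧ ip r v (rho r) < 1 := by
    rw [ip_of_form hf]
    have p1 := rho_pos a
    have p2 := rho_lt a
    have p3 := rho_pos b
    have p4 := rho_lt b
    rcases hs with h | h
    · rw [h]; push_cast; constructor <;> linarith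
    · have hne : a ≠ b := by
        intro e; have := hab e; omega
      have := rho_anti (lt_of_le_of_ne hle hne)
      rw [h]; push_cast; constructor <;> linarith
  apply Submodule.subset_span
  refine ⟨_, ?_, rfl⟩
  rw [← hR]
  apply refl_lt hr
  rw [hfn, hfn]
  rcases h with ⟨h1, h2⟩ | ⟨h1, h2⟩
  · right
    have : (1 : ℝ) ≤ N := by exact_mod_cast h1
    constructor <;> linarith
  · left
    have : (N : ℝ) ≤ 0 := by exact_mod_cast h1
    constructor <;> linarith

theorem X_mul (u w : E r) : X F r u * X F r w = X F r (u + w) := by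
  simp [X, AddMonoidAlgebra.single_mul_single]

theorem geom_mem (hr : 2 ≤ r) (v : E r) (hv : v ∈ PhiPlus r) (y : E r) (c : F) (d m : ℤ)
    (hd : d = 0 ∨ d = 1) (hm : m = ⌊(ip r v y + d) / 2⌋) :
    X F r ((-(d : ℝ)) • coroot r v) * geomS F r c ((-2 : ℝ) • coroot r v) (-m) *
        X F r (sRefl r v y) +
      (if ip r v y = 2 * m - d ∧ 0 < m then c ^ (-m) else 0) • X F r y ∈ ltSpan F r y := by
  have f1 : (m : ℝ) ≤ (ip r v y + d) / 2 := by rw [hm]; exact Int.floor_le _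
  have f2 : (ip r v y + d) / 2 < m + 1 := by rw [hm]; exact Int.lt_floor_add_one _
  have hfix : ∀ N : ℝ, ip r v y = N → N • coroot r v + sRefl r v y = y := by
    intro N h; simp [sRefl, h]
  have hterm : ∀ t : ℝ, X F r ((-(d : ℝ)) • coroot r v) * X F r (t • (-2 : ℝ) • coroot r v) *
      X F r (sRefl r v y) = X F r ((-d - 2 * t : ℝ) • coroot r v + sRefl r v y) := by
    intro t
    rw [X_mul, X_mul]
    congr 1
    module
  rcases le_or_gt m 0 with hm0 | hm0
  · rw [if_neg (by omega), zero_smul, add_zero]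
    unfold geomS
    rw [if_pos (by omega), Finset.mul_sum, Finset.sum_mul]
    apply Submodule.sum_mem
    intro t ht
    rw [Finset.mem_range] at ht
    rw [mul_smul_comm, smul_mul_assoc, hterm]
    apply Submodule.smul_mem
    have htm : (t : ℤ) < -m := by omega
    have htm' : (t : ℝ) + 1 ≤ -m := by exact_mod_cast htm
    have := refl_mem F hr v hv y (-d - 2 * t) (Or.inr ⟨by omega, by push_cast; linarith⟩)
    push_cast at this
    exact this
  · unfold geomS
    rw [if_neg (by omega), mul_neg, neg_mul, Finset.mul_sum, Finset.sum_mul, neg_neg]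
    obtain ⟨M, rfl⟩ : ∃ M : ℕ, m = M + 1 := ⟨(m - 1).toNat, by omega⟩
    have e : ((M : ℤ) + 1).toNat = M + 1 := by omega
    rw [e, Finset.sum_range_succ, neg_add, add_assoc]
    push_cast at f1 f2
    apply Submodule.add_mem
    · apply Submodule.neg_mem
      apply Submodule.sum_mem
      intro t ht
      rw [Finset.mem_range] at ht
      rw [mul_smul_comm, smul_mul_assoc, hterm]
      apply Submodule.smul_mem
      have htm' : (t : ℝ) + 1 ≤ M := by exact_mod_cast ht
      have := refl_mem F hr v hv y (2 * (t + 1) - d)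
        (Or.inl ⟨by omega, by push_cast; linarith⟩)
      push_cast at this
      convert this using 4
      ring
    · rw [mul_smul_comm, smul_mul_assoc, hterm]
      by_cases hz : ip r v y = 2 * ((M + 1 : ℤ) : ℝ) - d
      · rw [if_pos ⟨hz, hm0⟩, hfix]
        · rw [show (-(M : ℤ) - 1) = -((M : ℤ) + 1) by ring]
          simp
        · rw [hz]; push_cast; ring
      · rw [if_neg (fun h => hz h.1), zero_smul, add_zero]
        apply Submodule.neg_mem
        apply Submodule.smul_mem
        have := refl_mem F hr v hv y (2 * (M + 1) - d)
          (Or.inl ⟨by omega, by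
            push_cast at hz ⊢
            apply lt_of_le_of_ne _ (Ne.symm hz)
            linarith⟩)
        push_cast at this
        convert this using 4
        ring

theorem tcU_succ (t : Fin r → Fˣ) (m : Fin r) : tcU F r t ((m : ℕ) + 1) = t m := by
  unfold tcU
  rw [Finset.prod_eq_single m]
  · simp
  · intro b _ hb
    rw [if_neg]
    intro h
    exact hb (Fin.ext (by omega))
  · simp

theorem torus_form {w : E r → E r} {σ : Equiv.Perm (Fin r)} {ε lam : Fin r → ℤ}
    (h : IsForm r w σ ε lam) (qh : Fˣ) (t : Fin r → Fˣ) (m : Fin r) :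
    torusAct F r qh w t m = (qh * qh) ^ lam m * t (σ m) ^ ε m := by
  obtain ⟨-, h2⟩ := h
  have e0 : w 0 m = lam m := by rw [h2]; simp
  unfold torusAct
  rw [e0, Int.floor_intCast]
  congr 1
  rw [Finset.prod_eq_single (σ m)]
  · congr 1
    rw [Pi.sub_apply, e0, h2]
    simp [eV]
  · intro b _ hb
    rw [Pi.sub_apply, e0, h2]
    simp [eV, hb.symm]
  · simp

theorem torus_closed (hr : 2 ≤ r) (qh : Fˣ) (c : E r) (hc : c ∈ CplusCl r) (t : Fin r → Fˣ)
    (ht : ∀ j : ℕ, j ≤ r → alphaF r j c = 0 → tpowCo F r qh t j = 1) :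
    (∀ i, c i = 0 → t i = 1) ∧ (∀ i, c i = 1 / 2 → t i = qh) ∧
      ∀ i j, c i = c j → t i = t j := by
  have hstep : ∀ i (hi : i + 1 < r), c ⟨i, by omega⟩ = c ⟨i + 1, hi⟩ →
      t ⟨i, by omega⟩ = t ⟨i + 1, hi⟩ := by
    intro i hi hce
    have := ht (i + 1) hi.le
    have h1 := cd_succ r c ⟨i, by omega⟩
    have h2 := cd_succ r c ⟨i + 1, by omega⟩
    have h3 := tcU_succ F t ⟨i, by omega⟩
    have h4 := tcU_succ F t ⟨i + 1, by omega⟩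
    simp only at h1 h2 h3 h4
    simp only [alphaF, tpowCo, h1, h2, h3, h4, if_neg (show i + 1 ≠ r by omega)] at this
    simp only [Nat.succ_ne_zero, if_false] at this
    exact mul_inv_eq_one.1 (this (by linarith))
  have hind : ∀ (d i : ℕ) (hi : i + d < r), c ⟨i, by omega⟩ = c ⟨i + d, hi⟩ →
      t ⟨i, by omega⟩ = t ⟨i + d, hi⟩ := by
    intro d
    induction d with
    | zero => intro i hi _; rfl
    | succ d ih =>
      intro i hi hce
      have m1 := hc.1 ⟨i, by omega⟩ ⟨i + d, by omega⟩ (by rw [Fin.le_def]; simp)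
      have m2 := hc.1 ⟨i + d, by omega⟩ ⟨i + d + 1, hi⟩ (by rw [Fin.le_def]; simp)
      have hce' : c ⟨i, by omega⟩ = c ⟨i + d + 1, hi⟩ := hce
      exact (ih i (by omega) (by linarith)).trans (hstep (i + d) hi (by linarith))
  have hle : ∀ i j : Fin r, i ≤ j → c i = c j → t i = t j := by
    intro i j hij hce
    have hij' : (i : ℕ) ≤ j := hij
    have e : j = ⟨(i : ℕ) + (j - i), by omega⟩ := Fin.ext (by simp; omega)
    have := hind (j - i) i (by omega)
    rw [← e] at this
    exact this hce
  have heq : ∀ i j : Fin r, c i = c j → t i = t j := by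
    intro i j hce
    rcases le_total i j with h | h
    · exact hle i j h hce
    · exact (hle j i h hce.symm).symm
  refine ⟨?_, ?_, heq⟩
  · intro i hi
    have e1 := cd_succ r c ⟨r - 1, by omega⟩
    have e2 := tcU_succ F t ⟨r - 1, by omega⟩
    simp only [Nat.sub_add_cancel (show 1 ≤ r by omega)] at e1 e2
    have m := hc.1 i ⟨r - 1, by omega⟩ (by rw [Fin.le_def]; simp; omega)
    have m0 := (hc.2 ⟨r - 1, by omega⟩).1
    have := ht r le_rfl
    simp only [alphaF, tpowCo, e1, e2, if_neg (show r ≠ 0 by omega), if_true] at this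
    have hz : c ⟨r - 1, by omega⟩ = 0 := by linarith
    rw [heq i ⟨r - 1, by omega⟩ (by rw [hi, hz])]
    exact this (by rw [hz]; simp)
  · intro i hi
    have e1 := cd_succ r c ⟨0, by omega⟩
    have e2 := tcU_succ F t ⟨0, by omega⟩
    simp only [zero_add] at e1 e2
    have m := hc.1 ⟨0, by omega⟩ i (by rw [Fin.le_def]; simp)
    have m0 := (hc.2 ⟨0, by omega⟩).2
    have := ht 0 (by omega)
    simp only [alphaF, tpowCo, e1, e2, if_true] at this
    have hz : c ⟨0, by omega⟩ = 1 / 2 := by linarith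
    rw [heq i ⟨0, by omega⟩ (by rw [hi, hz])]
    exact (mul_inv_eq_one.1 (this (by rw [hz]; norm_num))).symm

theorem torus_pair (qh : Fˣ) (c : E r) (hc : c ∈ CplusCl r) (t : Fin r → Fˣ)
    (h0 : ∀ i, c i = 0 → t i = 1) (h1 : ∀ i, c i = 1 / 2 → t i = qh)
    (h2 : ∀ i j, c i = c j → t i = t j) (i j : Fin r) (e f K : ℤ)
    (he : e = 1 ∨ e = -1) (hf : f = 1 ∨ f = -1) (hK : e * c i + f * c j = K) :
    t i ^ e * t j ^ f = (qh * qh) ^ K := by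
  have key : ∀ (f K : ℤ), (f = 1 ∨ f = -1) → c i + f * c j = K →
      t i * t j ^ f = (qh * qh) ^ K := by
    intro f K hf hK
    have a1 := hc.2 i
    have a2 := hc.2 j
    rcases hf with rfl | rfl
    · push_cast at hK
      have hK0 : (-1 : ℝ) < K := by linarith
      have hK1 : (K : ℝ) < 2 := by linarith
      have hK0' : -1 < K := by exact_mod_cast hK0
      have hK1' : K < 2 := by exact_mod_cast hK1
      have : K = 0 ∨ K = 1 := by omega
      rcases this with rfl | rfl
      · push_cast at hK
        rw [h0 i (by linarith), h0 j (by linarith)]; simp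
      · push_cast at hK
        rw [h1 i (by linarith), h1 j (by linarith)]; simp
    · push_cast at hK
      have hK0 : (-1 : ℝ) < K := by linarith
      have hK1 : (K : ℝ) < 1 := by linarith
      have hK0' : -1 < K := by exact_mod_cast hK0
      have hK1' : K < 1 := by exact_mod_cast hK1
      have : K = 0 := by omega
      subst this
      push_cast at hK
      rw [h2 i j (by linarith)]; simp
  rcases he with rfl | rfl
  · have := key f K hf (by push_cast at hK; linarith)
    simpa using this
  · have := key (-f) (-K) (by rcases hf with h | h <;> simp [h]) (by
      push_cast at hK ⊢; linarith)
    rw [zpow_neg, zpow_neg] at this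
    rw [zpow_neg_one, ← inv_inj, ← this, mul_inv, inv_inv]

theorem torus_single (qh : Fˣ) (c : E r) (hc : c ∈ CplusCl r) (t : Fin r → Fˣ)
    (h0 : ∀ i, c i = 0 → t i = 1) (h1 : ∀ i, c i = 1 / 2 → t i = qh)
    (i : Fin r) (e K : ℤ) (he : e = 1 ∨ e = -1) (hK : 2 * (e * c i) = K) :
    t i ^ e = qh ^ K := by
  have a1 := hc.2 i
  have key : ∀ K : ℤ, 2 * c i = K → t i = qh ^ K := by
    intro K hK
    have hK0 : (-1 : ℝ) < K := by linarith
    have hK1 : (K : ℝ) < 2 := by linarith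
    have hK0' : -1 < K := by exact_mod_cast hK0
    have hK1' : K < 2 := by exact_mod_cast hK1
    have : K = 0 ∨ K = 1 := by omega
    rcases this with rfl | rfl
    · push_cast at hK
      rw [h0 i (by linarith)]; simp
    · push_cast at hK
      rw [h1 i (by linarith)]; simp
  rcases he with rfl | rfl
  · have := key K (by push_cast at hK; linarith)
    simpa using this
  · have := key (-K) (by push_cast at hK ⊢; linarith)
    rw [this, ← zpow_mul]; simp

theorem cpt_word (hr : 2 ≤ r) (O : Set (E r)) (hO : IsOrbit r O) (y : E r) (hy : y ∈ O) :
    cpt r O ∈ CplusCl r ∧ wordAct r (gW r y) (cpt r O) = y := by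
  obtain ⟨y0, rfl⟩ := hO
  obtain ⟨l, hl, hly⟩ := hy
  obtain ⟨g1, g2, -⟩ := gW_spec hr y
  set c := wordAct r (gW r y).reverse y with hcdef
  have hyc : wordAct r (gW r y) c = y := word_rev' r hr _ g1 y
  have hex : ∃ c, c ∈ orbit r y0 ∧ c ∈ CplusCl r := by
    refine ⟨c, ⟨(gW r y).reverse ++ l, ?_, ?_⟩, g2⟩
    · intro a ha
      rcases List.mem_append.1 ha with h | h
      · exact g1 a (by simpa using h)
      · exact hl a h
    · rw [word_append, hly]
  have hspec : cpt r (orbit r y0) ∈ orbit r y0 ∧ cpt r (orbit r y0) ∈ CplusCl r := by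
    unfold cpt
    rw [dif_pos hex]
    exact hex.choose_spec
  refine ⟨hspec.2, ?_⟩
  obtain ⟨l1, hl1, h1⟩ := hspec.1
  have hw : wordAct r (l1 ++ (l.reverse ++ gW r y)) c = cpt r (orbit r y0) := by
    rw [word_append, word_append, hyc, ← hly, word_rev r hr l hl, h1]
  have := alcove_unique hr (l1 ++ (l.reverse ++ gW r y)) (by
    intro a ha
    rcases List.mem_append.1 ha with h | h
    · exact hl1 a h
    rcases List.mem_append.1 h with h | h
    · exact hl a (by simpa using h)
    · exact g1 a h) c g2 (by rw [hw]; exact hspec.2)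
  rw [← hw, this, hyc]

theorem torus_main (hr : 2 ≤ r) (qh : Fˣ) (O : Set (E r)) (hO : IsOrbit r O)
    (t : Fin r → Fˣ) (ht : t ∈ TOset F r qh O) (v : E r) (hv : v ∈ PhiPlus r) (n : ℤ)
    (y : E r) (hy : y ∈ O) (N : ℤ) (hN : ip r v y = N) :
    upowR F r (torusAct F r qh (gfun r y) t) (((-n : ℤ) : ℝ) • coroot r v) =
      (qsc F r qh v n) ^ (-N) := by
  obtain ⟨hc, hyc⟩ := cpt_word hr O hO y hy
  obtain ⟨h0, h1, h2⟩ := torus_closed F hr qh (cpt r O) hc t ht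
  obtain ⟨σ, ε, lam, hform⟩ := word_form r hr (gW r y) (gW_spec hr y).1
  have hT : ∀ m, torusAct F r qh (gfun r y) t m = (qh * qh) ^ lam m * t (σ m) ^ ε m :=
    fun m => torus_form F hform qh t m
  have hY : ∀ m, y m = lam m + ε m * cpt r O (σ m) := by
    intro m; conv_lhs => rw [← hyc]
    exact hform.2 _ m
  obtain ⟨a, b, s, hs, hle, hab, hf⟩ := phi_cases v hv
  set T := torusAct F r qh (gfun r y) t with hTdef
  rw [ip_of_form hf] at hN
  unfold upowR
  by_cases e : a = b
  · have hs1 := hab e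
    subst e; subst hs1
    have hq : qsc F r qh v n = qh ^ n := by
      unfold qsc; rw [if_pos (by rw [ipvv_of_form hs hab hf]; simp)]
    rw [hq, Finset.prod_eq_single a]
    · rw [Pi.smul_apply, coroot_of_form hs hab hf]
      simp only [if_true, smul_eq_mul, Int.cast_one, mul_one]
      have hfn : ⌊((-n : ℤ) : ℝ)⌋ = -n := Int.floor_intCast _
      rw [hfn]
      have hs := torus_single F qh (cpt r O) hc t h0 h1 (σ a) (ε a) (N - 2 * lam a)
        (hform.1 a) (by rw [hY] at hN; push_cast at hN ⊢; linarith)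
      have : T a = qh ^ N := by
        rw [hT, hs, ← zpow_two, ← zpow_mul, ← zpow_add]; congr 1; ring
      rw [this, ← zpow_mul, ← zpow_mul]; congr 1; ring
    · intro m _ hm
      rw [Pi.smul_apply, coroot_of_form hs hab hf]
      simp [hm]
    · simp
  · have hq : qsc F r qh v n = (qh * qh) ^ n := by
      unfold qsc; rw [if_neg (by rw [ipvv_of_form hs hab hf, if_neg e]; norm_num)]
    have hprod : ∏ m, T m ^ ⌊(((-n : ℤ) : ℝ) • coroot r v) m⌋ = T a ^ (-n) * T b ^ (-n * s) := by
      have hfl : ∀ m, ⌊(((-n : ℤ) : ℝ) • coroot r v) m⌋ =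
          (if m = a then -n else 0) + (if m = b then -n * s else 0) := by
        intro m
        rw [Pi.smul_apply, coroot_of_form hs hab hf, if_neg e]
        rw [← Int.floor_intCast (R := ℝ) ((if m = a then -n else 0) + (if m = b then -n * s else 0))]
        congr 1
        push_cast
        by_cases hma : m = a
        · subst hma; simp [e]
        · by_cases hmb : m = b
          · subst hmb; simp [Ne.symm e]
          · simp [hma, hmb]
      simp only [hfl, zpow_add, Finset.prod_mul_distrib]
      congr 1
      · rw [Finset.prod_eq_single a]
        · simp
        · intro m _ hm; simp [hm]
        · simp
      · rw [Finset.prod_eq_single b]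
        · simp
        · intro m _ hm; simp [hm]
        · simp
    rw [hprod, hq]
    have hp := torus_pair F qh (cpt r O) hc t h0 h1 h2 (σ a) (σ b) (ε a) (s * ε b)
      (N - lam a - s * lam b) (hform.1 a)
      (by rcases hs with h | h <;> rcases hform.1 b with h' | h' <;> simp [h, h'])
      (by rw [hY, hY b] at hN; push_cast at hN ⊢; linarith)
    have hTT : T a * T b ^ s = (qh * qh) ^ N := by
      have e1 : N = lam a + s * lam b + (N - lam a - s * lam b) := by ring
      rw [hT a, hT b, mul_zpow ((qh * qh) ^ lam b), ← zpow_mul, ← zpow_mul]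
      conv_rhs => rw [e1, zpow_add, zpow_add, ← hp]
      rw [mul_comm (lam b) s, mul_comm (ε b) s]
      rw [mul_mul_mul_comm]
    rw [mul_comm (-n) s, zpow_mul (T b) s, ← mul_zpow, hTT, ← zpow_mul, ← zpow_mul]
    congr 1; ring

/-! ### PART D : the final assembly -/

theorem mkOp_X (Ψ : E r → QA F r) (y : E r) : mkOp F r Ψ (X F r y) = Ψ y := by
  simp [mkOp, X]

theorem scalar_main (A B q τ : Fˣ) (z : ℝ) (m m' : ℤ) (hm : m = ⌊z / 2⌋)
    (hm' : m' = ⌊(z + 1) / 2⌋) (hτ : ∀ N : ℤ, z = N → τ = q ^ (-N)) :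
    (A : F) ^ chiE z * (B : F) ^ chiO z - ((A ^ (-etaE z) * B ^ (-etaO z) : Fˣ) : F)
      = ((A : F) - (A : F)⁻¹) * τ *
          (if z = 2 * m - ((0 : ℤ) : ℝ) ∧ 0 < m then ((q⁻¹ * q⁻¹ : Fˣ) : F) ^ (-m) else 0)
        + ((B : F) - (B : F)⁻¹) * ((q⁻¹ : Fˣ) : F) * τ *
          (if z = 2 * m' - ((1 : ℤ) : ℝ) ∧ 0 < m' then ((q⁻¹ * q⁻¹ : Fˣ) : F) ^ (-m') else 0) := by
  by_cases hE : ∃ p : ℤ, z = 2 * p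
  · obtain ⟨p, hp⟩ := hE
    have hmp : m = p := by
      rw [hm, hp, mul_div_cancel_left₀ _ (two_ne_zero)]; exact Int.floor_intCast p
    have hO : ¬ ∃ p : ℤ, z = 2 * p + 1 := by
      rintro ⟨p', hp'⟩
      have : (2 * p : ℝ) = 2 * p' + 1 := by rw [← hp, hp']
      have : 2 * p = 2 * p' + 1 := by exact_mod_cast this
      omega
    have hE : ∃ p : ℤ, z = 2 * p := ⟨p, hp⟩
    have hO' : ¬ (z = 2 * m' - ((1 : ℤ) : ℝ) ∧ 0 < m') := by
      rintro ⟨h, -⟩; exact hO ⟨m' - 1, by push_cast at h ⊢; linarith⟩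
    rw [if_neg hO', mul_zero, add_zero]
    simp only [chiE, chiO, etaE, etaO, if_pos hE, if_neg hO]
    have hτ' := hτ (2 * p) (by push_cast; exact hp)
    subst hmp
    by_cases hpos : 0 < m
    · have h2 : (2 : ℝ) ≤ z := by
        rw [hp]; have : (1 : ℝ) ≤ m := by exact_mod_cast hpos
        linarith
      rw [if_pos h2, if_pos ⟨by rw [hp]; simp, hpos⟩]
      have : τ * (q⁻¹ * q⁻¹) ^ (-m) = 1 := by
        rw [hτ', mul_zpow, inv_zpow', neg_neg, ← zpow_add, ← zpow_add]
        rw [show -(2 * m) + (m + m) = 0 by ring, zpow_zero]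
      have h3 : (τ : F) * ((q⁻¹ * q⁻¹ : Fˣ) : F) ^ (-m) = 1 := by
        rw [← Units.val_zpow_eq_zpow_val, ← Units.val_mul, this, Units.val_one]
      rw [mul_assoc, h3]
      simp
    · have h2 : ¬ (2 : ℝ) ≤ z := by
        rw [hp]; intro h
        have : (1 : ℝ) ≤ m := by linarith
        have : 1 ≤ m := by exact_mod_cast this
        omega
      rw [if_neg h2, if_neg (fun h => hpos h.2)]
      simp
  · have hE' : ¬ (z = 2 * m - ((0 : ℤ) : ℝ) ∧ 0 < m) := by
      rintro ⟨h, -⟩; exact hE ⟨m, by simpa using h⟩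
    rw [if_neg hE', mul_zero, zero_add]
    by_cases hO : ∃ p : ℤ, z = 2 * p + 1
    · simp only [chiE, chiO, etaE, etaO, if_neg hE, if_pos hO]
      obtain ⟨p, hp⟩ := hO
      have hmp : m' = p + 1 := by
        rw [hm', hp, show ((2 * p + 1 + 1 : ℝ)) / 2 = ((p + 1 : ℤ) : ℝ) by push_cast; ring]
        exact Int.floor_intCast _
      have hτ' := hτ (2 * p + 1) (by push_cast; exact hp)
      by_cases hpos : 0 < m'
      · have h2 : (1 : ℝ) ≤ z := by
          rw [hp]; have : (0 : ℝ) ≤ p := by exact_mod_cast (by omega : 0 ≤ p)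
          linarith
        rw [if_pos h2, if_pos ⟨by rw [hp, hmp]; push_cast; ring, hpos⟩]
        have : q⁻¹ * τ * (q⁻¹ * q⁻¹) ^ (-m') = 1 := by
          rw [hτ', mul_zpow, inv_zpow', neg_neg, ← zpow_add, ← zpow_neg_one, ← zpow_add,
            ← zpow_add, hmp]
          rw [show -1 + -(2 * p + 1) + (p + 1 + (p + 1)) = 0 by ring, zpow_zero]
        have h3 : ((q⁻¹ : Fˣ) : F) * (τ : F) * ((q⁻¹ * q⁻¹ : Fˣ) : F) ^ (-m') = 1 := by
          rw [← Units.val_zpow_eq_zpow_val, ← Units.val_mul, ← Units.val_mul, this, Units.val_one]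
        rw [mul_assoc, mul_assoc, ← mul_assoc ((q⁻¹ : Fˣ) : F), h3]
        simp
      · have h2 : ¬ (1 : ℝ) ≤ z := by
          rw [hp]; intro h
          have : (0 : ℝ) ≤ p := by linarith
          have : 0 ≤ p := by exact_mod_cast this
          omega
        rw [if_neg h2, if_neg (fun h => hpos h.2)]
        simp
    · have hO' : ¬ (z = 2 * m' - ((1 : ℤ) : ℝ) ∧ 0 < m') := by
        rintro ⟨h, -⟩; exact hO ⟨m' - 1, by push_cast at h ⊢; linarith⟩
      rw [if_neg hO']
      simp [chiE, chiO, etaE, etaO, if_neg hE, if_neg hO]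

theorem main_thm (hr : 2 ≤ r)
    (qh k0 u0 k kr ur : Fˣ) (O : Set (E r)) (hO : IsOrbit r O)
    (t : Fin r → Fˣ) (ht : t ∈ TOset F r qh O)
    (v : E r) (hv : v ∈ PhiPlus r) (n : ℤ) (y : E r) (hy : y ∈ O) :
      Gop F r qh k0 u0 k kr ur t v n (X F r y)
          - ((kaf F r k0 k kr v n ^ (-etaE (ip r v y)) *
                khaf F r u0 k ur v n ^ (-etaO (ip r v y)) : Fˣ) : F) • X F r y
        ∈ ltSpan F r y := by
  rw [Gop, mkOp_X]
  unfold Gel saTel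
  set A := kaf F r k0 k kr v n
  set B := khaf F r u0 k ur v n
  set q := qsc F r qh v n with hq
  set τ := upowR F r (torusAct F r qh (gfun r y) t) (((-n : ℤ) : ℝ) • coroot r v) with hτdef
  have hτ : ∀ N : ℤ, ip r v y = N → τ = q ^ (-N) := fun N hN =>
    torus_main F hr qh O hO t ht v hv n y hy N hN
  set z := ip r v y with hz
  have e1 : -floorE z / 2 = -⌊z / 2⌋ := by unfold floorE; omega
  have e2 : -(floorO z + 1) / 2 = -⌊(z + 1) / 2⌋ := by unfold floorO; omega
  rw [e1, e2]
  have g1 := geom_mem F hr v hv y (((q⁻¹ * q⁻¹ : Fˣ)) : F) 0 ⌊z / 2⌋ (Or.inl rfl)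
    (by rw [← hz]; simp)
  have g2 := geom_mem F hr v hv y (((q⁻¹ * q⁻¹ : Fˣ)) : F) 1 ⌊(z + 1) / 2⌋ (Or.inr rfl)
    (by rw [← hz]; simp)
  rw [← hz] at g1 g2
  have hs := scalar_main F A B q τ z _ _ rfl rfl hτ
  have hX0 : X F r ((-((0 : ℤ) : ℝ)) • coroot r v) = 1 := by
    simp [X, AddMonoidAlgebra.one_def]
  have hX1 : (-((1 : ℤ) : ℝ)) • coroot r v = (-1 : ℝ) • coroot r v := by simp
  rw [hX0, one_mul] at g1
  rw [hX1] at g2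
  have := (ltSpan F r y).add_mem
    ((ltSpan F r y).smul_mem (((A : F) - (A : F)⁻¹) * τ) g1)
    ((ltSpan F r y).smul_mem (((B : F) - (B : F)⁻¹) * ((q⁻¹ : Fˣ) : F) * τ) g2)
  convert this using 1
  rw [smul_add, smul_add, smul_smul, smul_smul, add_add_add_comm, ← add_smul, ← hs]
  generalize geomS F r (((q⁻¹ * q⁻¹ : Fˣ)) : F) ((-2 : ℝ) • coroot r v) (-⌊z / 2⌋) = G1
  generalize geomS F r (((q⁻¹ * q⁻¹ : Fˣ)) : F) ((-2 : ℝ) • coroot r v) (-⌊(z + 1) / 2⌋) = G2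
  generalize X F r ((-1 : ℝ) • coroot r v) = G3
  generalize X F r (sRefl r v y) = G4
  generalize X F r y = G5
  simp only [Algebra.smul_def, map_mul, map_sub]
  ring

end Helpers

/-- Triangularity of `G_t^𝒪(a)` for affine roots `a = (α, n)` with
`α ∈ Φ₀⁺`: `G_t^𝒪(a)(x^y) = 𝐤_a^{-η_e(α(y))} 𝐤_{a/2}^{-η_o(α(y))} x^y + l.o.t.`. -/
theorem statement17 (F : Type*) [Field F] [CharZero F] (r : ℕ) (hr : 2 ≤ r)
    (qh k0 u0 k kr ur : Fˣ) (O : Set (E r)) (hO : IsOrbit r O)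
    (t : Fin r → Fˣ) (ht : t ∈ TOset F r qh O)
    (v : E r) (hv : v ∈ PhiPlus r) (n : ℤ) :
    ∀ y ∈ O,
      Gop F r qh k0 u0 k kr ur t v n (X F r y)
          - ((kaf F r k0 k kr v n ^ (-etaE (ip r v y)) *
                khaf F r u0 k ur v n ^ (-etaO (ip r v y)) : Fˣ) : F) • X F r y
        ∈ ltSpan F r y := by
  intro y hy
  exact main_thm F hr qh k0 u0 k kr ur O hO t ht v hv n y hy

end QP

end
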